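/- arXiv:2007.01218 — 8 statements merged into one kernel-verified Lean document; each statement's English description precedes it below -/
import Mathlib

section
/- Let v₀ : [0,1] → ℝ be absolutely continuous with weak derivative ∂ₓv₀ ∈ L²([0,1]), with ∫₀¹ v₀(s)ds = 1 and ‖∂ₓv₀‖_{L²} < 1/4. Then v₀(x) > 3/4 for every x ∈ [0,1], and the function u₀ = C(v₀) = −2 ∂ₓv₀/v₀ satisfies ‖u₀‖_{L²([0,1])} < 2/3 (pointwise one has |u₀(x)| ≤ (8/3)|∂ₓv₀(x)| almost everywhere). -/
open MeasureTheory Real Set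

/-- The `L²([0,1])` norm of a real function. -/
noncomputable def L2norm (f : ℝ → ℝ) : ℝ := Real.sqrt (∫ s in (0:ℝ)..1, f s ^ 2)

/-- If `v₀` is absolutely continuous on `[0,1]` with weak derivative
`dv ∈ L²([0,1])`, `∫₀¹ v₀ = 1` and `‖dv‖_{L²} < 1/4`, then `v₀ > 3/4` on `[0,1]`, the
inverse Cole-Hopf transform `u₀ = C(v₀) = -2 dv / v₀` satisfies `‖u₀‖_{L²} < 2/3`, and
pointwise a.e. `|u₀ x| ≤ (8/3) |dv x|`. -/
theorem L2norm_coleHopf_lt (v₀ dv : ℝ → ℝ)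
    (hdv_int : IntervalIntegrable dv volume 0 1)
    (hdv_sq : IntervalIntegrable (fun s => dv s ^ 2) volume 0 1)
    (hAC : ∀ x ∈ Icc (0:ℝ) 1, v₀ x = v₀ 0 + ∫ s in (0:ℝ)..x, dv s)
    (hmean : (∫ s in (0:ℝ)..1, v₀ s) = 1)
    (hsmall : L2norm dv < 1/4) :
    (∀ x ∈ Icc (0:ℝ) 1, 3/4 < v₀ x) ∧
    L2norm (fun x => -2 * dv x / v₀ x) < 2/3 ∧
    (∀ᵐ x ∂(volume.restrict (Icc (0:ℝ) 1)), |(-2) * dv x / v₀ x| ≤ 8/3 * |dv x|) := by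
  have h01 : (0:ℝ) ≤ 1 := zero_le_one
  have hI : (∫ s in (0:ℝ)..1, dv s ^ 2) < 1/16 := by
    unfold L2norm at hsmall
    rw [Real.sqrt_lt' (by norm_num)] at hsmall
    norm_num at hsmall ⊢
    exact hsmall
  have hA : (∫ s in (0:ℝ)..1, |dv s|) < 1/4 := by
    have h1 : (∫ s in (0:ℝ)..1, |dv s|) ≤ ∫ s in (0:ℝ)..1, (2 * dv s ^ 2 + 1/8) := by
      apply intervalIntegral.integral_mono_on h01 hdv_int.abs
      · exact (hdv_sq.const_mul 2).add intervalIntegrable_const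
      · intro x _
        nlinarith [sq_nonneg (|dv x| - 1/4), sq_abs (dv x)]
    rw [intervalIntegral.integral_add (hdv_sq.const_mul 2) intervalIntegrable_const,
      intervalIntegral.integral_const_mul, intervalIntegral.integral_const] at h1
    norm_num at h1
    norm_num at hI
    linarith
  have hsub : ∀ x ∈ Icc (0:ℝ) 1, IntervalIntegrable dv volume 0 x := by
    intro x hx
    apply hdv_int.mono_set
    rw [uIcc_of_le hx.1, uIcc_of_le h01]
    exact Icc_subset_Icc le_rfl hx.2
  have hdiff : ∀ x ∈ Icc (0:ℝ) 1, ∀ y ∈ Icc (0:ℝ) 1,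
      v₀ y ≤ v₀ x + ∫ s in (0:ℝ)..1, |dv s| := by
    intro x hx y hy
    have e : v₀ y - v₀ x = ∫ s in x..y, dv s := by
      rw [hAC x hx, hAC y hy,
        ← intervalIntegral.integral_interval_sub_left (hsub y hy) (hsub x hx)]
      ring
    have h2 : |∫ s in x..y, dv s| ≤ ∫ s in (0:ℝ)..1, |dv s| := by
      have h3 := intervalIntegral.norm_integral_le_integral_norm_uIoc
        (f := dv) (a := x) (b := y) (μ := volume)
      simp only [Real.norm_eq_abs] at h3
      refine h3.trans ?_
      rw [intervalIntegral.integral_of_le h01]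
      apply setIntegral_mono_set
      · exact ((intervalIntegrable_iff_integrableOn_Ioc_of_le h01).1 hdv_int.abs)
      · exact Filter.Eventually.of_forall fun _ => abs_nonneg _
      · apply LE.le.eventuallyLE
        exact Ioc_subset_Ioc (le_min hx.1 hy.1) (max_le hx.2 hy.2)
    have := le_abs_self (∫ s in x..y, dv s)
    linarith
  have hcont : ContinuousOn v₀ (Icc 0 1) := by
    have h4 : ContinuousOn (fun x => v₀ 0 + ∫ s in (0:ℝ)..x, dv s) (Icc 0 1) := by
      apply continuousOn_const.add
      have := intervalIntegral.continuousOn_primitive_interval' hdv_int left_mem_uIcc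
      rwa [uIcc_of_le h01] at this
    exact h4.congr hAC
  have hv : ∀ x ∈ Icc (0:ℝ) 1, 3/4 < v₀ x := by
    intro x hx
    have h5 := intervalIntegral.integral_mono_on (μ := volume) h01
      (hcont.intervalIntegrable_of_Icc h01)
      (intervalIntegrable_const (c := v₀ x + ∫ s in (0:ℝ)..1, |dv s|)) (hdiff x hx)
    rw [hmean, intervalIntegral.integral_const] at h5
    simp at h5
    linarith
  have hpt : ∀ x ∈ Icc (0:ℝ) 1, |(-2) * dv x / v₀ x| ≤ 8/3 * |dv x| := by
    intro x hx
    have h6 := hv x hx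
    have h7 : 0 < v₀ x := by linarith
    rw [abs_div, abs_mul, abs_of_pos h7, div_le_iff₀ h7]
    norm_num
    nlinarith [abs_nonneg (dv x)]
  refine ⟨hv, ?_, ?_⟩
  · unfold L2norm
    rw [Real.sqrt_lt' (by norm_num)]
    have h8 : (∫ s in (0:ℝ)..1, (-2 * dv s / v₀ s) ^ 2)
        ≤ ∫ s in (0:ℝ)..1, 64/9 * dv s ^ 2 := by
      rw [intervalIntegral.integral_of_le h01, intervalIntegral.integral_of_le h01]
      apply integral_mono_of_nonneg
      · exact Filter.Eventually.of_forall fun _ => sq_nonneg _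
      · exact (intervalIntegrable_iff_integrableOn_Ioc_of_le h01).1 (hdv_sq.const_mul _)
      · refine (ae_restrict_iff' measurableSet_Ioc).2 (Filter.Eventually.of_forall ?_)
        intro x hx
        have h9 := hpt x (Ioc_subset_Icc_self hx)
        have h10 := pow_le_pow_left₀ (abs_nonneg _) h9 2
        rw [mul_pow, sq_abs, sq_abs] at h10
        norm_num at h10 ⊢
        exact h10
    rw [intervalIntegral.integral_const_mul] at h8
    linarith
  · exact (ae_restrict_iff' measurableSet_Icc).2 (Filter.Eventually.of_forall hpt)
end

section
/- For every u₀ ∈ L²([0,1]), the function H(u₀) is absolutely continuous with weak derivative ∂ₓH(u₀)(x) = −(1/2) u₀(x) H(u₀)(x) for almost every x, and ‖∂ₓH(u₀)‖_{L²([0,1])} ≤ (1/2) e^{‖u₀‖_{L²}} ‖u₀‖_{L²}. -/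
open MeasureTheory Real Set

/-- The Cole-Hopf transform `H`. -/
noncomputable def coleHopfH (u : ℝ → ℝ) : ℝ → ℝ := fun x =>
  Real.exp (-(1/2) * ∫ s in (0:ℝ)..x, u s) /
    ∫ y in (0:ℝ)..1, Real.exp (-(1/2) * ∫ s in (0:ℝ)..y, u s)

theorem ac_lipschitz_comp {f g : ℝ → ℝ} {a b : ℝ} {K : NNReal} {s : Set ℝ}
    (hg : LipschitzOnWith K g s) (hf : AbsolutelyContinuousOnInterval f a b)
    (hm : ∀ x ∈ uIcc a b, f x ∈ s) :
    AbsolutelyContinuousOnInterval (fun x => g (f x)) a b := by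
  rw [absolutelyContinuousOnInterval_iff] at hf ⊢
  intro ε hε
  obtain ⟨δ, hδ, h⟩ := hf (ε / (K + 1)) (by positivity)
  refine ⟨δ, hδ, fun E hE hlt => ?_⟩
  have h1 := h E hE hlt
  calc
    _ ≤ ∑ i ∈ Finset.range E.1, (K : ℝ) * dist (f (E.2 i).1) (f (E.2 i).2) := by
      apply Finset.sum_le_sum
      intro i hi
      exact hg.dist_le_mul _ (hm _ (hE.left i hi).left) _ (hm _ (hE.left i hi).right)
    _ = K * ∑ i ∈ Finset.range E.1, dist (f (E.2 i).1) (f (E.2 i).2) :=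
      (Finset.mul_sum _ _ _).symm
    _ ≤ K * (ε / (K + 1)) := by gcongr
    _ < (K + 1) * (ε / (K + 1)) := by gcongr; linarith
    _ = ε := by field_simp

theorem abs_primitive_le (u : ℝ → ℝ) (hu : IntervalIntegrable u volume 0 1)
    (hsq : IntervalIntegrable (fun s => u s ^ 2) volume 0 1) (x : ℝ) (hx : x ∈ Icc (0:ℝ) 1) :
    |∫ s in (0:ℝ)..x, u s| ≤ L2norm u := by
  have h1 : |∫ s in (0:ℝ)..x, u s| ≤ ∫ s in (0:ℝ)..x, |u s| :=
    intervalIntegral.abs_integral_le_integral_abs hx.1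
  have h2 : ∫ s in (0:ℝ)..x, |u s| ≤ ∫ s in (0:ℝ)..1, |u s| :=
    intervalIntegral.integral_mono_interval le_rfl hx.1 hx.2
      (Filter.Eventually.of_forall fun _ => abs_nonneg _) hu.abs
  refine (h1.trans h2).trans ?_
  set A := ∫ s in (0:ℝ)..1, |u s| with hA
  apply Real.le_sqrt_of_sq_le
  have h3 : ∫ s in (0:ℝ)..1, (2 * A * |u s| - A ^ 2) ≤ ∫ s in (0:ℝ)..1, u s ^ 2 := by
    apply intervalIntegral.integral_mono_on zero_le_one
      ((hu.abs.const_mul _).sub intervalIntegrable_const) hsq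
    intro s _
    nlinarith [sq_nonneg (|u s| - A), sq_abs (u s)]
  rw [intervalIntegral.integral_sub (hu.abs.const_mul _) intervalIntegrable_const,
    intervalIntegral.integral_const_mul, ← hA] at h3
  simp at h3
  nlinarith

/-- For every `u₀ ∈ L²([0,1])`, `H(u₀)` is absolutely continuous with weak
derivative `∂ₓH(u₀) = -(1/2) u₀ H(u₀)` (a.e. derivative, and primitive of it), and
`‖∂ₓH(u₀)‖_{L²} ≤ (1/2) exp(‖u₀‖_{L²}) ‖u₀‖_{L²}`. -/
theorem coleHopfH_absolutelyContinuous (u₀ : ℝ → ℝ)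
    (hu_int : IntervalIntegrable u₀ volume 0 1)
    (hu_sq : IntervalIntegrable (fun s => u₀ s ^ 2) volume 0 1) :
    (∀ x ∈ Icc (0:ℝ) 1,
      coleHopfH u₀ x = coleHopfH u₀ 0 + ∫ s in (0:ℝ)..x, -(1/2) * u₀ s * coleHopfH u₀ s) ∧
    (∀ᵐ x ∂(volume.restrict (Icc (0:ℝ) 1)),
      HasDerivAt (coleHopfH u₀) (-(1/2) * u₀ x * coleHopfH u₀ x) x) ∧
    L2norm (fun x => -(1/2) * u₀ x * coleHopfH u₀ x) ≤
      1/2 * Real.exp (L2norm u₀) * L2norm u₀ := by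
  have hN := abs_primitive_le u₀ hu_int hu_sq
  set N := L2norm u₀ with hNdef
  have hN0 : 0 ≤ N := Real.sqrt_nonneg _
  have hI : uIcc (0:ℝ) 1 = Icc 0 1 := uIcc_of_le zero_le_one
  set U : ℝ → ℝ := fun x => ∫ s in (0:ℝ)..x, u₀ s with hU
  have hUac : AbsolutelyContinuousOnInterval U 0 1 :=
    hu_int.absolutelyContinuousOnInterval_intervalIntegral (by simp)
  have hWac : AbsolutelyContinuousOnInterval (fun x => -(1/2) * U x) 0 1 := hUac.const_mul _
  have hWb : ∀ x ∈ Icc (0:ℝ) 1, -(1/2) * U x ∈ Icc (-(N/2)) (N/2) := by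
    intro x hx
    have := abs_le.1 (hN x hx)
    constructor <;> simp only [hU] <;> linarith [this.1, this.2]
  obtain ⟨K, hK⟩ := (Real.contDiff_exp (n := 1)).contDiffOn.exists_lipschitzOnWith
    (s := Icc (-(N/2)) (N/2)) (by decide) (convex_Icc _ _) isCompact_Icc
  have hEac : AbsolutelyContinuousOnInterval (fun x => Real.exp (-(1/2) * U x)) 0 1 :=
    ac_lipschitz_comp hK hWac (by rw [hI]; exact hWb)
  set c := ∫ y in (0:ℝ)..1, Real.exp (-(1/2) * U y) with hc
  have hH : coleHopfH u₀ = fun x => c⁻¹ * Real.exp (-(1/2) * U x) := by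
    funext x
    simp only [coleHopfH, hc, hU]
    rw [div_eq_inv_mul]
  have hcb : Real.exp (-(N/2)) ≤ c := by
    have : ∫ y in (0:ℝ)..1, Real.exp (-(N/2)) ≤ c := by
      apply intervalIntegral.integral_mono_on zero_le_one intervalIntegrable_const
        hEac.continuousOn.intervalIntegrable
      intro x hx
      exact Real.exp_le_exp.2 (hWb x hx).1
    simpa using this
  have hc0 : 0 < c := (Real.exp_pos _).trans_le hcb
  have hHac : AbsolutelyContinuousOnInterval (coleHopfH u₀) 0 1 := by
    rw [hH]; exact hEac.const_mul _
  have hHb : ∀ x ∈ Icc (0:ℝ) 1, 0 ≤ coleHopfH u₀ x ∧ coleHopfH u₀ x ≤ Real.exp N := by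
    intro x hx
    rw [hH]
    refine ⟨by positivity, ?_⟩
    change c⁻¹ * Real.exp (-(1/2) * U x) ≤ Real.exp N
    rw [inv_mul_le_iff₀ hc0]
    calc Real.exp (-(1/2) * U x) ≤ Real.exp (N/2) := Real.exp_le_exp.2 (hWb x hx).2
      _ = Real.exp (-(N/2)) * Real.exp N := by rw [← Real.exp_add]; congr 1; ring
      _ ≤ c * Real.exp N := by gcongr
  have hD : ∀ᵐ x, x ∈ Icc (0:ℝ) 1 →
      HasDerivAt (coleHopfH u₀) (-(1/2) * u₀ x * coleHopfH u₀ x) x := by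
    filter_upwards [hu_int.ae_hasDerivAt_integral] with x hx hxI
    rw [hI] at hx
    have h1 : HasDerivAt U (u₀ x) x := hx hxI 0 (by simp)
    rw [hH]
    refine ((h1.const_mul (-(1/2))).exp.const_mul c⁻¹).congr_deriv ?_
    ring
  refine ⟨?_, (ae_restrict_iff' measurableSet_Icc).2 hD, ?_⟩
  · intro x hx
    have hx' : uIcc 0 x ⊆ uIcc (0:ℝ) 1 := by
      rw [hI, uIcc_of_le hx.1]; exact Icc_subset_Icc_right hx.2
    have h1 := (hHac.mono hx').integral_deriv_eq_sub
    have h2 : ∫ s in (0:ℝ)..x, -(1/2) * u₀ s * coleHopfH u₀ s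
        = ∫ s in (0:ℝ)..x, deriv (coleHopfH u₀) s := by
      apply intervalIntegral.integral_congr_ae
      filter_upwards [hD] with s hs hsI
      exact (hs (hI ▸ hx' (uIoc_subset_uIcc hsI))).deriv.symm
    rw [h2, h1]; ring
  · have hHc : ContinuousOn (fun x => (coleHopfH u₀ x) ^ 2) (uIcc 0 1) :=
      hHac.continuousOn.pow 2
    have h1 : ∫ s in (0:ℝ)..1, (-(1/2) * u₀ s * coleHopfH u₀ s) ^ 2
        ≤ ∫ s in (0:ℝ)..1, (1/2 * Real.exp N) ^ 2 * u₀ s ^ 2 := by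
      apply intervalIntegral.integral_mono_on zero_le_one _ (hu_sq.const_mul _)
      · intro s hs
        have hb := hHb s hs
        have : coleHopfH u₀ s ^ 2 ≤ Real.exp N ^ 2 := pow_le_pow_left₀ hb.1 hb.2 2
        nlinarith [mul_le_mul_of_nonneg_left this (sq_nonneg (u₀ s))]
      · have := (hu_sq.mul_continuousOn hHc).const_mul (1/4)
        refine this.congr ?_
        intro s _
        ring
    rw [intervalIntegral.integral_const_mul] at h1
    have h2 := Real.sqrt_le_sqrt h1
    rw [Real.sqrt_mul (sq_nonneg _), Real.sqrt_sq (by positivity)] at h2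
    exact h2
end

section
/- Let u₀ ∈ L²([0,1]) be absolutely continuous with weak derivative ∂ₓu₀ ∈ L²([0,1]) and u₀(0) = u₀(1) = 0. Then v₀ = H(u₀) has a second weak derivative ∂ₓₓv₀ = −(1/2)(v₀ ∂ₓu₀ + u₀ ∂ₓv₀) ∈ L²([0,1]), and ‖∂ₓₓv₀‖_{L²([0,1])} ≤ (1/2) e^{‖u₀‖_{L²}} ‖∂ₓu₀‖_{L²} (1 + ‖u₀‖_{L²}/2). -/
open MeasureTheory Real Set

theorem cs_aux (f g : ℝ → ℝ)
    (hf : IntervalIntegrable (fun s => f s ^ 2) volume 0 1)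
    (hg : IntervalIntegrable (fun s => g s ^ 2) volume 0 1)
    (hfg : IntervalIntegrable (fun s => f s * g s) volume 0 1) :
    ∫ s in (0:ℝ)..1, f s * g s ≤ L2norm f * L2norm g := by
  have hF : 0 ≤ ∫ s in (0:ℝ)..1, f s ^ 2 :=
    intervalIntegral.integral_nonneg zero_le_one (fun _ _ => sq_nonneg _)
  have key : ∀ t : ℝ, 0 ≤ (∫ s in (0:ℝ)..1, f s ^ 2) * (t * t)
      + (2 * ∫ s in (0:ℝ)..1, f s * g s) * t + ∫ s in (0:ℝ)..1, g s ^ 2 := by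
    intro t
    have h0 : 0 ≤ ∫ s in (0:ℝ)..1, ((t * t) * f s ^ 2 + (2 * t) * (f s * g s) + g s ^ 2) :=
      intervalIntegral.integral_nonneg zero_le_one (fun s _ => by
        nlinarith [sq_nonneg (t * f s + g s)])
    rw [intervalIntegral.integral_add ((hf.const_mul _).add (hfg.const_mul _)) hg,
      intervalIntegral.integral_add (hf.const_mul _) (hfg.const_mul _),
      intervalIntegral.integral_const_mul, intervalIntegral.integral_const_mul] at h0
    linarith
  have hd := discrim_le_zero key
  unfold discrim at hd
  unfold L2norm
  rw [← Real.sqrt_mul hF]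
  apply Real.le_sqrt_of_sq_le
  linarith

theorem abs_sq_aux (f : ℝ → ℝ) : L2norm (fun s => |f s|) = L2norm f := by
  unfold L2norm
  simp only [sq_abs]

theorem abs_integral_aux (f : ℝ → ℝ) (hi : IntervalIntegrable f volume 0 1)
    (hf : IntervalIntegrable (fun s => f s ^ 2) volume 0 1) {x : ℝ} (hx : x ∈ Icc (0:ℝ) 1) :
    |∫ s in (0:ℝ)..x, f s| ≤ L2norm f := by
  have h1 : |∫ s in (0:ℝ)..x, f s| ≤ ∫ s in (0:ℝ)..x, |f s| :=
    intervalIntegral.abs_integral_le_integral_abs hx.1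
  have h2 : ∫ s in (0:ℝ)..x, |f s| ≤ ∫ s in (0:ℝ)..1, |f s| := by
    apply intervalIntegral.integral_mono_interval le_rfl hx.1 hx.2 _ hi.abs
    exact Filter.Eventually.of_forall (fun _ => abs_nonneg _)
  have h3 := cs_aux (fun s => |f s|) (fun _ => 1) (by simpa only [sq_abs] using hf)
    (by simp) (by simpa using hi.abs)
  rw [abs_sq_aux] at h3
  have h4 : L2norm (fun _ => 1) = 1 := by simp [L2norm]
  rw [h4] at h3
  simp only [mul_one] at h3
  linarith

theorem parts_aux (d v v' : ℝ → ℝ) (hd : IntervalIntegrable d volume 0 1)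
    (hv : ∀ x, HasDerivAt v (v' x) x) (hv' : Continuous v') {x : ℝ} (hx : x ∈ Icc (0:ℝ) 1) :
    (∫ s in (0:ℝ)..x, d s) * v x =
      ∫ s in (0:ℝ)..x, (d s * v s + (∫ r in (0:ℝ)..s, d r) * v' s) := by
  have hdx : IntervalIntegrable d volume 0 x := hd.mono_set (by
    rw [uIcc_of_le hx.1, uIcc_of_le zero_le_one]; exact Icc_subset_Icc le_rfl hx.2)
  have hF := hdx.absolutelyContinuousOnInterval_intervalIntegral (c := 0) (by simp)
  have hder : deriv v = v' := funext fun y => (hv y).deriv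
  have hvC : ContDiff ℝ 1 v :=
    contDiff_one_iff_deriv.2 ⟨fun y => (hv y).differentiableAt, by rw [hder]; exact hv'⟩
  have hG : AbsolutelyContinuousOnInterval v 0 x :=
    hvC.contDiffOn.absolutelyContinuousOnInterval
  have h := hF.integral_deriv_mul_eq_sub hG
  simp only [intervalIntegral.integral_same, zero_mul, sub_zero] at h
  rw [← h]
  apply intervalIntegral.integral_congr_ae
  filter_upwards [hdx.ae_hasDerivAt_integral] with y hy hy2
  have hy3 := hy (uIoc_subset_uIcc hy2) 0 (by simp)
  rw [hy3.deriv, hder]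

/-- If `u₀ ∈ L²([0,1])` is absolutely continuous with weak derivative
`du ∈ L²([0,1])` and `u₀(0) = u₀(1) = 0`, then `v₀ = H(u₀)` (whose first weak derivative is
`dv₀ = -(1/2) u₀ v₀`) has second weak derivative `ddv₀ = -(1/2)(v₀ du + u₀ dv₀) ∈ L²([0,1])`,
with `‖ddv₀‖_{L²} ≤ (1/2) exp(‖u₀‖_{L²}) ‖du‖_{L²} (1 + ‖u₀‖_{L²}/2)`. -/
theorem coleHopfH_second_weak_derivative (u₀ du : ℝ → ℝ)
    (hu_int : IntervalIntegrable u₀ volume 0 1)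
    (hu_sq : IntervalIntegrable (fun s => u₀ s ^ 2) volume 0 1)
    (hdu_int : IntervalIntegrable du volume 0 1)
    (hdu_sq : IntervalIntegrable (fun s => du s ^ 2) volume 0 1)
    (hAC : ∀ x ∈ Icc (0:ℝ) 1, u₀ x = u₀ 0 + ∫ s in (0:ℝ)..x, du s)
    (hb0 : u₀ 0 = 0) (hb1 : u₀ 1 = 0) :
    (∀ x ∈ Icc (0:ℝ) 1,
      -(1/2) * u₀ x * coleHopfH u₀ x = -(1/2) * u₀ 0 * coleHopfH u₀ 0 +
        ∫ s in (0:ℝ)..x,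
          -(1/2) * (coleHopfH u₀ s * du s + u₀ s * (-(1/2) * u₀ s * coleHopfH u₀ s))) ∧
    IntervalIntegrable
      (fun s => (-(1/2) * (coleHopfH u₀ s * du s + u₀ s * (-(1/2) * u₀ s * coleHopfH u₀ s))) ^ 2)
      volume 0 1 ∧
    L2norm (fun s => -(1/2) * (coleHopfH u₀ s * du s + u₀ s * (-(1/2) * u₀ s * coleHopfH u₀ s)))
      ≤ 1/2 * Real.exp (L2norm u₀) * L2norm du * (1 + L2norm u₀ / 2) := by
  have hI : uIcc (0:ℝ) 1 = Icc 0 1 := uIcc_of_le zero_le_one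
  set F : ℝ → ℝ := fun x => ∫ s in (0:ℝ)..x, du s with hFdef
  have hF : ∀ x ∈ Icc (0:ℝ) 1, u₀ x = F x := fun x hx => by
    rw [hAC x hx, hb0, zero_add]
  have hFc : ContinuousOn F (Icc 0 1) := by
    rw [← hI]
    exact (hdu_int.absolutelyContinuousOnInterval_intervalIntegral (c := 0)
      (by simp)).continuousOn
  have huc : ContinuousOn u₀ (Icc 0 1) := hFc.congr hF
  -- continuous extension of u₀
  set w : ℝ → ℝ := IccExtend (zero_le_one (α := ℝ)) ((Icc (0:ℝ) 1).domRestrict u₀) with hw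
  have hwc : Continuous w := (continuousOn_iff_continuous_domRestrict.1 huc).Icc_extend'
  have hwu : ∀ x ∈ Icc (0:ℝ) 1, w x = u₀ x := fun x hx => by
    rw [hw, IccExtend_of_mem _ _ hx]; rfl
  have hU : ∀ x ∈ Icc (0:ℝ) 1, ∫ s in (0:ℝ)..x, u₀ s = ∫ s in (0:ℝ)..x, w s := fun x hx => by
    apply intervalIntegral.integral_congr
    intro y hy
    rw [uIcc_of_le hx.1] at hy
    exact (hwu y ⟨hy.1, hy.2.trans hx.2⟩).symm
  set Z : ℝ := ∫ y in (0:ℝ)..1, Real.exp (-(1/2) * ∫ s in (0:ℝ)..y, u₀ s) with hZ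
  set v : ℝ → ℝ := fun x => Real.exp (-(1/2) * ∫ s in (0:ℝ)..x, w s) / Z with hv
  have hHv : ∀ x ∈ Icc (0:ℝ) 1, coleHopfH u₀ x = v x := fun x hx => by
    simp only [coleHopfH, hv, ← hZ, hU x hx]
  have hvd : ∀ x, HasDerivAt v (-(1/2) * w x * v x) x := fun x => by
    have h1 : HasDerivAt (fun x => ∫ s in (0:ℝ)..x, w s) (w x) x :=
      hwc.integral_hasStrictDerivAt 0 x |>.hasDerivAt
    have h2 := ((h1.const_mul (-(1/2))).exp).div_const Z
    have e : -(1/2) * w x * v x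
        = Real.exp (-(1/2) * ∫ s in (0:ℝ)..x, w s) * (-(1/2) * w x) / Z := by
      simp only [hv]; ring
    rw [e]
    exact h2
  have hvc : Continuous v := continuous_iff_continuousAt.2 fun x => (hvd x).continuousAt
  -- bounds
  have hA0 : 0 ≤ L2norm u₀ := Real.sqrt_nonneg _
  have hB0 : 0 ≤ L2norm du := Real.sqrt_nonneg _
  set A := L2norm u₀ with hA
  set B := L2norm du with hB
  have hUb : ∀ x ∈ Icc (0:ℝ) 1, |∫ s in (0:ℝ)..x, u₀ s| ≤ A := fun x hx =>
    abs_integral_aux u₀ hu_int hu_sq hx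
  have hub : ∀ x ∈ Icc (0:ℝ) 1, |u₀ x| ≤ B := fun x hx => by
    rw [hF x hx]; exact abs_integral_aux du hdu_int hdu_sq hx
  have hUc : ContinuousOn (fun x => ∫ s in (0:ℝ)..x, u₀ s) (Icc 0 1) := by
    rw [← hI]
    exact (hu_int.absolutelyContinuousOnInterval_intervalIntegral (c := 0)
      (by simp)).continuousOn
  have hZb : Real.exp (-(A/2)) ≤ Z := by
    have h1 : ∫ y in (0:ℝ)..1, Real.exp (-(A/2)) ≤ Z := by
      apply intervalIntegral.integral_mono_on zero_le_one (by simp)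
      · apply ContinuousOn.intervalIntegrable
        rw [hI]
        exact (continuousOn_const.mul hUc).rexp
      · intro x hx
        apply Real.exp_le_exp.2
        have := (abs_le.1 (hUb x hx)).2
        linarith
    simpa using h1
  have hZ0 : 0 < Z := (Real.exp_pos _).trans_le hZb
  have hvb : ∀ x ∈ Icc (0:ℝ) 1, 0 ≤ v x ∧ v x ≤ Real.exp A := fun x hx => by
    refine ⟨by positivity, ?_⟩
    rw [hv]
    simp only
    rw [div_le_iff₀ hZ0, ← hU x hx]
    calc Real.exp (-(1/2) * ∫ s in (0:ℝ)..x, u₀ s) ≤ Real.exp (A + -(A/2)) := by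
          apply Real.exp_le_exp.2
          have := (abs_le.1 (hUb x hx)).1
          linarith
      _ = Real.exp A * Real.exp (-(A/2)) := Real.exp_add _ _
      _ ≤ _ := by gcongr
  -- the integrand
  set G : ℝ → ℝ := fun s =>
    -(1/2) * (coleHopfH u₀ s * du s + u₀ s * (-(1/2) * u₀ s * coleHopfH u₀ s)) with hG
  have hGv : ∀ s ∈ Icc (0:ℝ) 1, G s = -(1/2) * v s * (du s - w s ^ 2 / 2) := fun s hs => by
    simp only [hG, hHv s hs, hwu s hs]; ring
  have hI2 : uIoc (0:ℝ) 1 ⊆ Icc 0 1 := by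
    rw [uIoc_of_le zero_le_one]; exact Ioc_subset_Icc_self
  -- integrability of the square
  have hint : IntervalIntegrable (fun s => (G s) ^ 2) volume 0 1 := by
    have h1 : IntervalIntegrable (fun s => (1/4 * v s ^ 2) * du s ^ 2
        + (-(1/4) * v s ^ 2 * w s ^ 2) * du s + 1/16 * v s ^ 2 * w s ^ 4) volume 0 1 := by
      refine ((hdu_sq.continuousOn_mul ?_).add (hdu_int.continuousOn_mul ?_)).add ?_
      · exact Continuous.continuousOn (by fun_prop)
      · exact Continuous.continuousOn (by fun_prop)
      · exact Continuous.intervalIntegrable (by fun_prop) _ _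
    refine h1.congr ?_
    intro s hs
    simp only [hGv s (hI2 hs)]; ring
  have hmix : IntervalIntegrable (fun s => |du s| * |u₀ s|) volume 0 1 := by
    apply hdu_int.abs.mul_continuousOn
    rw [hI]; exact huc.abs
  refine ⟨?_, hint, ?_⟩
  · intro x hx
    have hp := parts_aux du v _ hdu_int hvd (by fun_prop) hx
    rw [hb0, hHv x hx, hF x hx]
    rw [show -(1/2) * F x * v x = -(1/2) * (F x * v x) by ring, hFdef]
    simp only
    rw [hp, ← intervalIntegral.integral_const_mul]
    simp only [mul_zero, zero_mul, zero_add]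
    apply intervalIntegral.integral_congr
    intro s hs
    rw [uIcc_of_le hx.1] at hs
    have hs' : s ∈ Icc (0:ℝ) 1 := ⟨hs.1, hs.2.trans hx.2⟩
    have e := hF s hs'
    simp only [hFdef] at e
    simp only [hG, hHv s hs', hwu s hs', ← e]; ring
  · have hcs := cs_aux (fun s => |du s|) (fun s => |u₀ s|) (by simpa only [sq_abs] using hdu_sq)
      (by simpa only [sq_abs] using hu_sq) hmix
    rw [abs_sq_aux, abs_sq_aux, ← hA, ← hB] at hcs
    have hA2 : ∫ s in (0:ℝ)..1, u₀ s ^ 2 = A ^ 2 := by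
      rw [hA, L2norm, Real.sq_sqrt]
      exact intervalIntegral.integral_nonneg zero_le_one (fun _ _ => sq_nonneg _)
    have hB2 : ∫ s in (0:ℝ)..1, du s ^ 2 = B ^ 2 := by
      rw [hB, L2norm, Real.sq_sqrt]
      exact intervalIntegral.integral_nonneg zero_le_one (fun _ _ => sq_nonneg _)
    unfold L2norm
    apply Real.sqrt_le_iff.2
    refine ⟨by positivity, ?_⟩
    have hm : ∫ s in (0:ℝ)..1, G s ^ 2 ≤ ∫ s in (0:ℝ)..1, (1/2 * Real.exp A) ^ 2 *
        (du s ^ 2 + B * (|du s| * |u₀ s|) + B ^ 2 / 4 * u₀ s ^ 2) := by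
      apply intervalIntegral.integral_mono_on zero_le_one hint
      · exact ((hdu_sq.add (hmix.const_mul _)).add (hu_sq.const_mul _)).const_mul _
      · intro s hs
        rw [hGv s hs, hwu s hs]
        obtain ⟨hv0, hv1⟩ := hvb s hs
        have hu1 := hub s hs
        have hb : |du s - u₀ s ^ 2 / 2| ≤ |du s| + B * |u₀ s| / 2 := by
          calc |du s - u₀ s ^ 2 / 2| ≤ |du s| + |u₀ s ^ 2 / 2| := abs_sub _ _
            _ = |du s| + |u₀ s| * |u₀ s| / 2 := by
                rw [abs_div, abs_pow, sq, abs_two]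
            _ ≤ _ := by gcongr
        have h1 : (du s - u₀ s ^ 2 / 2) ^ 2 ≤ (|du s| + B * |u₀ s| / 2) ^ 2 := by
          rw [← sq_abs (du s - u₀ s ^ 2 / 2)]; gcongr
        calc (-(1/2) * v s * (du s - u₀ s ^ 2 / 2)) ^ 2
            = (1/2 * v s) ^ 2 * (du s - u₀ s ^ 2 / 2) ^ 2 := by ring
          _ ≤ (1/2 * Real.exp A) ^ 2 * (|du s| + B * |u₀ s| / 2) ^ 2 := by gcongr
          _ = _ := by
            rw [← sq_abs (du s), ← sq_abs (u₀ s)]; ring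
    refine hm.trans ?_
    rw [intervalIntegral.integral_const_mul,
      intervalIntegral.integral_add (hdu_sq.add (hmix.const_mul _)) (hu_sq.const_mul _),
      intervalIntegral.integral_add hdu_sq (hmix.const_mul _),
      intervalIntegral.integral_const_mul, intervalIntegral.integral_const_mul, hA2, hB2]
    calc (1/2 * Real.exp A) ^ 2 * (B ^ 2 + B * (∫ s in (0:ℝ)..1, |du s| * |u₀ s|)
          + B ^ 2 / 4 * A ^ 2)
        ≤ (1/2 * Real.exp A) ^ 2 * (B ^ 2 + B * (B * A) + B ^ 2 / 4 * A ^ 2) := by gcongr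
      _ = _ := by ring
end

section
/- Let Ω ⊆ ℝ × ℝ be open and let v : Ω → ℝ be infinitely differentiable with v(t,x) > 0 on Ω and satisfying the heat equation ∂ₜv = ∂ₓₓv on Ω. Then the function u(t,x) = −2 ∂ₓv(t,x)/v(t,x) satisfies the Burgers equation ∂ₜu = −u ∂ₓu + ∂ₓₓu on Ω. -/
open Real Set

/-- Partial derivative with respect to the first (time) variable. -/
noncomputable def pdt (f : ℝ × ℝ → ℝ) : ℝ × ℝ → ℝ := fun p => deriv (fun t => f (t, p.2)) p.1

/-- Partial derivative with respect to the second (space) variable. -/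
noncomputable def pdx (f : ℝ × ℝ → ℝ) : ℝ × ℝ → ℝ := fun p => deriv (fun x => f (p.1, x)) p.2

theorem slice_x {Ω : Set (ℝ × ℝ)} (hΩ : IsOpen Ω) {f : ℝ × ℝ → ℝ}
    (hf : ContDiffOn ℝ (⊤ : ℕ∞) f Ω) {p : ℝ × ℝ} (hp : p ∈ Ω) :
    HasDerivAt (fun x => f (p.1, x)) (fderiv ℝ f p (0, 1)) p.2 := by
  have hd : DifferentiableAt ℝ f p :=
    (hf.contDiffAt (hΩ.mem_nhds hp)).differentiableAt (by simp)
  have h1 : HasDerivAt (fun x : ℝ => (p.1, x)) ((0 : ℝ), (1 : ℝ)) p.2 :=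
    (hasDerivAt_const _ _).prodMk (hasDerivAt_id _)
  exact HasFDerivAt.comp_hasDerivAt (f := fun x : ℝ => (p.1, x)) p.2 hd.hasFDerivAt h1

theorem slice_t {Ω : Set (ℝ × ℝ)} (hΩ : IsOpen Ω) {f : ℝ × ℝ → ℝ}
    (hf : ContDiffOn ℝ (⊤ : ℕ∞) f Ω) {p : ℝ × ℝ} (hp : p ∈ Ω) :
    HasDerivAt (fun t => f (t, p.2)) (fderiv ℝ f p (1, 0)) p.1 := by
  have hd : DifferentiableAt ℝ f p :=
    (hf.contDiffAt (hΩ.mem_nhds hp)).differentiableAt (by simp)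
  have h1 : HasDerivAt (fun t : ℝ => (t, p.2)) ((1 : ℝ), (0 : ℝ)) p.1 :=
    (hasDerivAt_id _).prodMk (hasDerivAt_const _ _)
  exact HasFDerivAt.comp_hasDerivAt (f := fun t : ℝ => (t, p.2)) p.1 hd.hasFDerivAt h1

theorem hasDeriv_x {Ω : Set (ℝ × ℝ)} (hΩ : IsOpen Ω) {f : ℝ × ℝ → ℝ}
    (hf : ContDiffOn ℝ (⊤ : ℕ∞) f Ω) {p : ℝ × ℝ} (hp : p ∈ Ω) :
    HasDerivAt (fun x => f (p.1, x)) (pdx f p) p.2 :=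
  (slice_x hΩ hf hp).differentiableAt.hasDerivAt

theorem hasDeriv_t {Ω : Set (ℝ × ℝ)} (hΩ : IsOpen Ω) {f : ℝ × ℝ → ℝ}
    (hf : ContDiffOn ℝ (⊤ : ℕ∞) f Ω) {p : ℝ × ℝ} (hp : p ∈ Ω) :
    HasDerivAt (fun t => f (t, p.2)) (pdt f p) p.1 :=
  (slice_t hΩ hf hp).differentiableAt.hasDerivAt

theorem smooth_fderiv {Ω : Set (ℝ × ℝ)} (hΩ : IsOpen Ω) {f : ℝ × ℝ → ℝ}
    (hf : ContDiffOn ℝ (⊤ : ℕ∞) f Ω) : ContDiffOn ℝ (⊤ : ℕ∞) (fderiv ℝ f) Ω :=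
  hf.fderiv_of_isOpen hΩ (by simp)

theorem smooth_pdx {Ω : Set (ℝ × ℝ)} (hΩ : IsOpen Ω) {f : ℝ × ℝ → ℝ}
    (hf : ContDiffOn ℝ (⊤ : ℕ∞) f Ω) : ContDiffOn ℝ (⊤ : ℕ∞) (pdx f) Ω :=
  ((smooth_fderiv hΩ hf).clm_apply contDiffOn_const).congr
    (fun _ hp => (slice_x hΩ hf hp).deriv)

theorem pdx_congr {Ω : Set (ℝ × ℝ)} (hΩ : IsOpen Ω) {f g : ℝ × ℝ → ℝ}
    (h : ∀ p ∈ Ω, f p = g p) {p : ℝ × ℝ} (hp : p ∈ Ω) : pdx f p = pdx g p := by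
  apply Filter.EventuallyEq.deriv_eq
  have hc : ContinuousAt (fun x : ℝ => (p.1, x)) p.2 := by fun_prop
  filter_upwards [hc.preimage_mem_nhds (hΩ.mem_nhds hp)] with x hx using h _ hx

theorem pdt_congr {Ω : Set (ℝ × ℝ)} (hΩ : IsOpen Ω) {f g : ℝ × ℝ → ℝ}
    (h : ∀ p ∈ Ω, f p = g p) {p : ℝ × ℝ} (hp : p ∈ Ω) : pdt f p = pdt g p := by
  apply Filter.EventuallyEq.deriv_eq
  have hc : ContinuousAt (fun t : ℝ => (t, p.2)) p.1 := by fun_prop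
  filter_upwards [hc.preimage_mem_nhds (hΩ.mem_nhds hp)] with x hx using h _ hx

theorem pd_comm {Ω : Set (ℝ × ℝ)} (hΩ : IsOpen Ω) {f : ℝ × ℝ → ℝ}
    (hf : ContDiffOn ℝ (⊤ : ℕ∞) f Ω) {p : ℝ × ℝ} (hp : p ∈ Ω) :
    pdt (pdx f) p = pdx (pdt f) p := by
  have hF := smooth_fderiv hΩ hf
  have hFd : DifferentiableAt ℝ (fderiv ℝ f) p :=
    (hF.contDiffAt (hΩ.mem_nhds hp)).differentiableAt (by simp)
  have key : ∀ w : ℝ × ℝ, ∀ z, fderiv ℝ (fun q => fderiv ℝ f q w) p z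
      = fderiv ℝ (fderiv ℝ f) p z w := by
    intro w z
    rw [fderiv_clm_apply hFd (differentiableAt_const _)]
    simp
  rw [pdt_congr hΩ (f := pdx f) (g := fun q => fderiv ℝ f q (0, 1))
      (fun q hq => (slice_x hΩ hf hq).deriv) hp,
    pdx_congr hΩ (f := pdt f) (g := fun q => fderiv ℝ f q (1, 0))
      (fun q hq => (slice_t hΩ hf hq).deriv) hp]
  have e1 := (slice_t hΩ (hF.clm_apply (contDiffOn_const (c := ((0 : ℝ), (1 : ℝ))))) hp).deriv
  have e2 := (slice_x hΩ (hF.clm_apply (contDiffOn_const (c := ((1 : ℝ), (0 : ℝ))))) hp).deriv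
  rw [key] at e1 e2
  refine e1.trans (Eq.trans ?_ e2.symm)
  have hs : IsSymmSndFDerivAt ℝ f p :=
    (hf.contDiffAt (hΩ.mem_nhds hp)).isSymmSndFDerivAt (by simp only [minSmoothness_of_isRCLikeNormedField]; exact WithTop.coe_le_coe.2 (le_top : (2 : ℕ∞) ≤ ⊤))
  exact hs _ _

/-- If `v` is smooth and positive on an open set `Ω ⊆ ℝ × ℝ` and solves the
heat equation `∂ₜ v = ∂ₓₓ v` there, then `u = -2 ∂ₓ v / v` solves the Burgers equation
`∂ₜ u = -u ∂ₓ u + ∂ₓₓ u` on `Ω`. -/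
theorem coleHopf_heat_to_burgers (Ω : Set (ℝ × ℝ)) (hΩ : IsOpen Ω)
    (v : ℝ × ℝ → ℝ) (hv : ContDiffOn ℝ (⊤ : ℕ∞) v Ω)
    (hpos : ∀ p ∈ Ω, 0 < v p)
    (hheat : ∀ p ∈ Ω, pdt v p = pdx (pdx v) p) :
    ∀ p ∈ Ω,
      pdt (fun q => -2 * pdx v q / v q) p =
        -(-2 * pdx v p / v p) * pdx (fun q => -2 * pdx v q / v q) p +
          pdx (pdx (fun q => -2 * pdx v q / v q)) p := by
  intro p hp
  have h1 := smooth_pdx hΩ hv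
  have h2 := smooth_pdx hΩ h1
  have ux : ∀ q ∈ Ω, pdx (fun q => -2 * pdx v q / v q) q =
      (-2 * pdx (pdx v) q * v q - -2 * pdx v q * pdx v q) / v q ^ 2 := fun q hq =>
    (((hasDeriv_x hΩ h1 hq).const_mul (-2)).div (hasDeriv_x hΩ hv hq) (hpos q hq).ne').deriv
  have ut : pdt (fun q => -2 * pdx v q / v q) p =
      (-2 * pdt (pdx v) p * v p - -2 * pdx v p * pdt v p) / v p ^ 2 :=
    (((hasDeriv_t hΩ h1 hp).const_mul (-2)).div (hasDeriv_t hΩ hv hp) (hpos p hp).ne').deriv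
  have hvp := (hpos p hp).ne'
  have A := hasDeriv_x hΩ hv hp
  have B := hasDeriv_x hΩ h1 hp
  have C := hasDeriv_x hΩ h2 hp
  have uxx := ((((C.const_mul (-2)).mul A).sub ((B.const_mul (-2)).mul B |>.congr_deriv rfl)).div
    (A.pow 2) (pow_ne_zero 2 hvp)).deriv
  have uxx' := (pdx_congr hΩ ux hp).trans ((show _ = _ from uxx))
  rw [uxx', ux p hp, ut, pd_comm hΩ hv hp, pdx_congr hΩ hheat hp, hheat p hp]
  simp
  field_simp
  ring
end

section
/- For every u₀ ∈ L²([0,1]), Σ_{n=1}^∞ n²π² lₙ(u₀)² ≤ (1/4) e^{2‖u₀‖_{L²}} ‖u₀‖²_{L²}. -/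
open MeasureTheory Real Set

/-- The cosine Fourier coefficient `cₙ(v) = √2 ∫₀¹ v(s) cos(nπs) ds`. -/
noncomputable def cCoef (n : ℕ) (v : ℝ → ℝ) : ℝ :=
  Real.sqrt 2 * ∫ s in (0:ℝ)..1, v s * Real.cos (n * π * s)

/-- `lₙ(u) = cₙ(H(u))`. -/
noncomputable def lCoef (n : ℕ) (u : ℝ → ℝ) : ℝ := cCoef n (coleHopfH u)

lemma aux_ac_comp {f : ℝ → ℝ} {a b : ℝ} {φ : ℝ → ℝ} {K : NNReal} {t : Set ℝ}
    (hf : AbsolutelyContinuousOnInterval f a b) (hφ : LipschitzOnWith K φ t)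
    (hft : ∀ x ∈ uIcc a b, f x ∈ t) :
    AbsolutelyContinuousOnInterval (fun x => φ (f x)) a b := by
  rw [absolutelyContinuousOnInterval_iff] at hf ⊢
  intro ε hε
  obtain ⟨δ, hδ, h⟩ := hf (ε / (K + 1)) (by positivity)
  refine ⟨δ, hδ, fun E hE hlt => ?_⟩
  have h1 := h E hE hlt
  have hK : (0:ℝ) ≤ K := K.2
  calc ∑ i ∈ Finset.range E.1, dist (φ (f (E.2 i).1)) (φ (f (E.2 i).2))
      ≤ ∑ i ∈ Finset.range E.1, K * dist (f (E.2 i).1) (f (E.2 i).2) := by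
        refine Finset.sum_le_sum fun i hi => ?_
        exact hφ.dist_le_mul _ (hft _ (hE.1 i hi).1) _ (hft _ (hE.1 i hi).2)
    _ = K * ∑ i ∈ Finset.range E.1, dist (f (E.2 i).1) (f (E.2 i).2) := by
        rw [Finset.mul_sum]
    _ ≤ K * (ε / (K + 1)) := by gcongr
    _ < ε := by
        rw [← mul_div_assoc, div_lt_iff₀ (by positivity)]
        nlinarith

lemma aux_int_cos (k : ℤ) (hk : k ≠ 0) : ∫ s in (0:ℝ)..1, cos (k * π * s) = 0 := by
  have : (k:ℝ) * π ≠ 0 := by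
    have : (k:ℝ) ≠ 0 := by exact_mod_cast hk
    positivity
  rw [intervalIntegral.integral_comp_mul_left (fun x => cos x) this, integral_cos]
  simp [Real.sin_int_mul_pi]

lemma aux_orth (m n : ℕ+) :
    ∫ s in (0:ℝ)..1, (√2 * sin ((m:ℕ) * π * s)) * (√2 * sin ((n:ℕ) * π * s))
      = if m = n then 1 else 0 := by
  have h2 : √2 * √2 = (2:ℝ) := Real.mul_self_sqrt (by norm_num)
  have h : ∀ s : ℝ, (√2 * sin ((m:ℕ) * π * s)) * (√2 * sin ((n:ℕ) * π * s))
      = cos (((m:ℤ) - (n:ℤ) : ℤ) * π * s) - cos (((m:ℤ) + (n:ℤ) : ℤ) * π * s) := by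
    intro s
    have := two_mul_sin_mul_sin ((m:ℕ) * π * s) ((n:ℕ) * π * s)
    push_cast
    rw [show ((m:ℕ):ℝ) * π * s - (n:ℕ) * π * s = (((m:ℕ):ℝ) - (n:ℕ)) * π * s by ring,
      show ((m:ℕ):ℝ) * π * s + (n:ℕ) * π * s = (((m:ℕ):ℝ) + (n:ℕ)) * π * s by ring] at this
    rw [← this]
    linear_combination (sin ((m:ℕ) * π * s) * sin ((n:ℕ) * π * s)) * h2
  simp_rw [h]
  rw [intervalIntegral.integral_sub (by apply Continuous.intervalIntegrable; fun_prop)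
    (by apply Continuous.intervalIntegrable; fun_prop)]
  have hm := m.pos
  have hn := n.pos
  rw [aux_int_cos ((m:ℤ) + (n:ℤ)) (by omega)]
  split_ifs with hmn
  · subst hmn; simp
  · rw [aux_int_cos]
    · simp
    · intro h0
      apply hmn
      apply PNat.coe_injective
      omega

/-- Bessel's inequality for the sine system. -/
lemma aux_bessel (g : ℝ → ℝ) (hg : MemLp g 2 (volume.restrict (Ioc (0:ℝ) 1)))
    (S : Finset ℕ+) :
    ∑ n ∈ S, (∫ s in (0:ℝ)..1, (√2 * sin ((n:ℕ) * π * s)) * g s) ^ 2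
      ≤ ∫ s in (0:ℝ)..1, g s ^ 2 := by
  set μ := volume.restrict (Ioc (0:ℝ) 1) with hμ
  let e : ℕ+ → ℝ → ℝ := fun n s => √2 * sin ((n:ℕ) * π * s)
  have he : ∀ n, MemLp (e n) 2 μ := by
    intro n
    refine MemLp.of_bound (C := √2) (by fun_prop) ?_
    refine Filter.Eventually.of_forall fun s => ?_
    simp only [e, norm_mul, Real.norm_eq_abs]
    rw [abs_of_nonneg (Real.sqrt_nonneg 2)]
    have := abs_sin_le_one ((n:ℕ) * π * s)
    nlinarith [Real.sqrt_nonneg 2]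
  have hin : ∀ (f h : ℝ → ℝ) (hf : MemLp f 2 μ) (hh : MemLp h 2 μ),
      inner ℝ (hf.toLp f) (hh.toLp h) = ∫ s in (0:ℝ)..1, f s * h s := by
    intro f h hf hh
    rw [L2.inner_def, intervalIntegral.integral_of_le zero_le_one]
    apply integral_congr_ae
    filter_upwards [hf.coeFn_toLp, hh.coeFn_toLp] with s h1 h2
    rw [h1, h2]
    simp [mul_comm]
  have ho : Orthonormal ℝ (fun n => (he n).toLp (e n)) := by
    rw [orthonormal_iff_ite]
    intro m n
    rw [hin]
    exact aux_orth m n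
  have hb := ho.sum_inner_products_le (hg.toLp g) (s := S)
  rw [← real_inner_self_eq_norm_sq, hin] at hb
  simp only [hin, Real.norm_eq_abs, sq_abs] at hb
  simpa [e, sq] using hb

lemma aux_abs_le (u : ℝ → ℝ) (h1 : IntervalIntegrable u volume 0 1)
    (h2 : IntervalIntegrable (fun s => u s ^ 2) volume 0 1) :
    ∫ s in (0:ℝ)..1, |u s| ≤ L2norm u := by
  unfold L2norm
  set m := ∫ s in (0:ℝ)..1, |u s| with hm
  apply Real.le_sqrt_of_sq_le
  have h0 : 0 ≤ ∫ s in (0:ℝ)..1, (u s ^ 2 - 2 * m * |u s| + m ^ 2) := by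
    apply intervalIntegral.integral_nonneg zero_le_one
    intro s _
    nlinarith [sq_nonneg (|u s| - m), sq_abs (u s)]
  rw [intervalIntegral.integral_add (h2.sub (h1.abs.const_mul _)) (by simp),
    intervalIntegral.integral_sub h2 (h1.abs.const_mul _),
    intervalIntegral.integral_const_mul, ← hm] at h0
  simp at h0
  nlinarith

lemma aux_U_le (u : ℝ → ℝ) (h1 : IntervalIntegrable u volume 0 1)
    (h2 : IntervalIntegrable (fun s => u s ^ 2) volume 0 1) (x : ℝ) (hx : x ∈ uIcc (0:ℝ) 1) :
    |∫ s in (0:ℝ)..x, u s| ≤ L2norm u := by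
  rw [uIcc_of_le zero_le_one] at hx
  refine le_trans ?_ (aux_abs_le u h1 h2)
  refine (intervalIntegral.abs_integral_le_integral_abs hx.1).trans ?_
  refine intervalIntegral.integral_mono_interval le_rfl hx.1 hx.2 ?_ h1.abs
  exact Filter.Eventually.of_forall fun s => abs_nonneg _

lemma aux_E_ac (u : ℝ → ℝ) (h1 : IntervalIntegrable u volume 0 1)
    (h2 : IntervalIntegrable (fun s => u s ^ 2) volume 0 1) :
    AbsolutelyContinuousOnInterval
      (fun x => Real.exp (-(1/2) * ∫ s in (0:ℝ)..x, u s)) 0 1 := by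
  have hU := h1.absolutelyContinuousOnInterval_intervalIntegral (c := 0) (by simp)
  have hc : ContDiff ℝ 1 (fun y : ℝ => Real.exp (-(1/2) * y)) := by fun_prop
  obtain ⟨K, hK⟩ := (hc.contDiffOn (s := Icc (-L2norm u) (L2norm u))).exists_lipschitzOnWith
    (by decide) (convex_Icc _ _) isCompact_Icc
  exact aux_ac_comp (φ := fun y : ℝ => Real.exp (-(1/2) * y)) hU hK fun x hx => abs_le.mp (aux_U_le u h1 h2 x hx)

lemma aux_H_ac (u : ℝ → ℝ) (h1 : IntervalIntegrable u volume 0 1)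
    (h2 : IntervalIntegrable (fun s => u s ^ 2) volume 0 1) :
    AbsolutelyContinuousOnInterval (coleHopfH u) 0 1 := by
  have := (aux_E_ac u h1 h2).const_mul
    (∫ y in (0:ℝ)..1, Real.exp (-(1/2) * ∫ s in (0:ℝ)..y, u s))⁻¹
  unfold coleHopfH
  simpa only [div_eq_inv_mul] using this

lemma aux_H_bound (u : ℝ → ℝ) (h1 : IntervalIntegrable u volume 0 1)
    (h2 : IntervalIntegrable (fun s => u s ^ 2) volume 0 1) (x : ℝ) (hx : x ∈ uIcc (0:ℝ) 1) :
    |coleHopfH u x| ≤ Real.exp (L2norm u) := by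
  have hD : Real.exp (-(1/2) * L2norm u) ≤
      ∫ y in (0:ℝ)..1, Real.exp (-(1/2) * ∫ s in (0:ℝ)..y, u s) := by
    have := intervalIntegral.integral_mono_on (μ := volume) (a := 0) (b := 1) zero_le_one
      (f := fun _ => Real.exp (-(1/2) * L2norm u))
      (g := fun y => Real.exp (-(1/2) * ∫ s in (0:ℝ)..y, u s)) (by simp)
      (aux_E_ac u h1 h2).continuousOn.intervalIntegrable ?_
    · simpa using this
    · intro y hy
      have := abs_le.mp (aux_U_le u h1 h2 y (by rwa [uIcc_of_le zero_le_one]))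
      apply Real.exp_le_exp.mpr
      linarith [this.2]
  have hp := Real.exp_pos (-(1/2) * L2norm u)
  unfold coleHopfH
  rw [abs_of_nonneg (div_nonneg (Real.exp_pos _).le (hp.le.trans hD)), div_le_iff₀ (hp.trans_le hD)]
  calc Real.exp (-(1/2) * ∫ s in (0:ℝ)..x, u s)
      ≤ Real.exp (L2norm u) * Real.exp (-(1/2) * L2norm u) := by
        rw [← Real.exp_add]
        apply Real.exp_le_exp.mpr
        linarith [(abs_le.mp (aux_U_le u h1 h2 x hx)).1]
    _ ≤ _ := by gcongr

lemma aux_parts (u : ℝ → ℝ) (h1 : IntervalIntegrable u volume 0 1)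
    (h2 : IntervalIntegrable (fun s => u s ^ 2) volume 0 1) (n : ℕ+) :
    ((n:ℕ):ℝ) * π * lCoef n u =
      ∫ s in (0:ℝ)..1, (√2 * sin ((n:ℕ) * π * s)) * (1/2 * (u s * coleHopfH u s)) := by
  have hv := aux_H_ac u h1 h2
  have hs : ContDiff ℝ 1 (fun s : ℝ => sin ((n:ℕ) * π * s)) := by fun_prop
  have hp := hv.integral_mul_deriv_eq_deriv_mul (hs.contDiffOn.absolutelyContinuousOnInterval)
  have hd : ∀ s : ℝ, deriv (fun s : ℝ => sin ((n:ℕ) * π * s)) s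
      = (n:ℕ) * π * cos ((n:ℕ) * π * s) := by
    intro s
    have : HasDerivAt (fun s : ℝ => sin ((n:ℕ) * π * s))
        (cos ((n:ℕ) * π * s) * ((n:ℕ) * π * 1)) s :=
      ((hasDerivAt_id s).const_mul _).sin
    rw [this.deriv]; ring
  simp only [hd, mul_one, mul_zero, sin_zero, sin_nat_mul_pi, sub_zero, zero_sub] at hp
  have hd2 : ∫ x in (0:ℝ)..1, deriv (coleHopfH u) x * sin ((n:ℕ) * π * x)
      = ∫ x in (0:ℝ)..1, (-(1/2) * u x * coleHopfH u x) * sin ((n:ℕ) * π * x) := by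
    apply intervalIntegral.integral_congr_ae
    filter_upwards [h1.ae_hasDerivAt_integral] with x hx hx2
    have hU := hx (uIoc_subset_uIcc hx2) 0 (by simp)
    have : HasDerivAt (coleHopfH u) (Real.exp (-(1/2) * ∫ s in (0:ℝ)..x, u s) * (-(1/2) * u x) /
        ∫ y in (0:ℝ)..1, Real.exp (-(1/2) * ∫ s in (0:ℝ)..y, u s)) x :=
      ((hU.const_mul _).exp).div_const _
    rw [this.deriv]
    unfold coleHopfH
    ring
  rw [hd2] at hp
  unfold lCoef cCoef
  calc ((n:ℕ):ℝ) * π * (√2 * ∫ s in (0:ℝ)..1, coleHopfH u s * cos ((n:ℕ) * π * s))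
      = √2 * ∫ s in (0:ℝ)..1, coleHopfH u s * ((n:ℕ) * π * cos ((n:ℕ) * π * s)) := by
        have : ∀ s : ℝ, coleHopfH u s * ((n:ℕ) * π * cos ((n:ℕ) * π * s))
          = ((n:ℕ) * π) * (coleHopfH u s * cos ((n:ℕ) * π * s)) := fun s => by ring
        simp_rw [this]
        rw [intervalIntegral.integral_const_mul]; ring
    _ = _ := by
        rw [hp, ← intervalIntegral.integral_neg, ← intervalIntegral.integral_const_mul]
        congr 1; ext s; ring

/-- For every `u₀ ∈ L²([0,1])`,
`Σ_{n≥1} n²π² lₙ(u₀)² ≤ (1/4) e^{2‖u₀‖_{L²}} ‖u₀‖²_{L²}`. -/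
theorem sum_sq_lCoef_le (u₀ : ℝ → ℝ)
    (hu_int : IntervalIntegrable u₀ volume 0 1)
    (hu_sq : IntervalIntegrable (fun s => u₀ s ^ 2) volume 0 1) :
    Summable (fun n : ℕ+ => ((n : ℕ) : ℝ) ^ 2 * π ^ 2 * lCoef (n : ℕ) u₀ ^ 2) ∧
    (∑' n : ℕ+, ((n : ℕ) : ℝ) ^ 2 * π ^ 2 * lCoef (n : ℕ) u₀ ^ 2) ≤
      1/4 * Real.exp (2 * L2norm u₀) * L2norm u₀ ^ 2 := by
  have hv := aux_H_ac u₀ hu_int hu_sq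
  have hum : AEStronglyMeasurable u₀ (volume.restrict (Ioc (0:ℝ) 1)) :=
    hu_int.aestronglyMeasurable
  have hu2 : MemLp u₀ 2 (volume.restrict (Ioc (0:ℝ) 1)) :=
    (memLp_two_iff_integrable_sq hum).2
      ((intervalIntegrable_iff_integrableOn_Ioc_of_le zero_le_one).1 hu_sq)
  have hvm : AEStronglyMeasurable (coleHopfH u₀) (volume.restrict (Ioc (0:ℝ) 1)) :=
    hv.continuousOn.intervalIntegrable.aestronglyMeasurable
  have hbd : ∀ x ∈ Ioc (0:ℝ) 1, |coleHopfH u₀ x| ≤ Real.exp (L2norm u₀) := fun x hx =>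
    aux_H_bound u₀ hu_int hu_sq x (by rw [uIcc_of_le zero_le_one]; exact Ioc_subset_Icc_self hx)
  have hg : MemLp (fun s => 1/2 * (u₀ s * coleHopfH u₀ s)) 2
      (volume.restrict (Ioc (0:ℝ) 1)) := by
    refine MemLp.of_le_mul (c := Real.exp (L2norm u₀)) hu2 ((hum.mul hvm).const_mul _) ?_
    filter_upwards [ae_restrict_mem measurableSet_Ioc] with x hx
    simp only [norm_mul, Real.norm_eq_abs]
    rw [abs_of_pos (by norm_num : (0:ℝ) < 1/2)]
    have := mul_le_mul_of_nonneg_left (hbd x hx) (abs_nonneg (u₀ x))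
    nlinarith [mul_nonneg (abs_nonneg (u₀ x)) (abs_nonneg (coleHopfH u₀ x))]
  have hgi : IntervalIntegrable (fun s => (1/2 * (u₀ s * coleHopfH u₀ s)) ^ 2) volume 0 1 :=
    (intervalIntegrable_iff_integrableOn_Ioc_of_le zero_le_one).2 hg.integrable_sq
  have hL : L2norm u₀ ^ 2 = ∫ s in (0:ℝ)..1, u₀ s ^ 2 := by
    unfold L2norm
    exact Real.sq_sqrt (intervalIntegral.integral_nonneg zero_le_one fun s _ => sq_nonneg _)
  have hfin : ∫ s in (0:ℝ)..1, (1/2 * (u₀ s * coleHopfH u₀ s)) ^ 2 ≤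
      1/4 * Real.exp (2 * L2norm u₀) * L2norm u₀ ^ 2 := by
    rw [hL, ← intervalIntegral.integral_const_mul]
    refine intervalIntegral.integral_mono_on zero_le_one hgi (hu_sq.const_mul _) ?_
    intro x hx
    have hb := aux_H_bound u₀ hu_int hu_sq x (by rwa [uIcc_of_le zero_le_one])
    have hb2 : coleHopfH u₀ x ^ 2 ≤ Real.exp (2 * L2norm u₀) := by
      rw [two_mul, Real.exp_add, ← sq, ← sq_abs]
      gcongr
    nlinarith [mul_le_mul_of_nonneg_left hb2 (sq_nonneg (u₀ x))]
  have hsum : ∀ S : Finset ℕ+,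
      ∑ n ∈ S, ((n : ℕ) : ℝ) ^ 2 * π ^ 2 * lCoef (n : ℕ) u₀ ^ 2 ≤
        1/4 * Real.exp (2 * L2norm u₀) * L2norm u₀ ^ 2 := by
    intro S
    refine le_trans (le_of_eq ?_) ((aux_bessel _ hg S).trans hfin)
    refine Finset.sum_congr rfl fun n _ => ?_
    rw [← aux_parts u₀ hu_int hu_sq n]
    ring
  have hnn : 0 ≤ (fun n : ℕ+ => ((n : ℕ) : ℝ) ^ 2 * π ^ 2 * lCoef (n : ℕ) u₀ ^ 2) :=
    fun n => by positivity
  exact ⟨summable_of_sum_le hnn hsum, Real.tsum_le_of_sum_le hnn hsum⟩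
end

section
/- Let u₀ ∈ Ω_B. Then for every t ≥ 0 and every x ∈ [0,1], the series defining v(t,x) converges absolutely and |v(t,x) − 1| ≤ 1/4; in particular v(t,x) ≥ 3/4 > 0 for all t ≥ 0 and x ∈ [0,1]. -/
open MeasureTheory Real Set

/-- `u₀ ∈ Ω_B` : `u₀ ∈ L²([0,1])` with `2 e^{‖u₀‖} ‖u₀‖ < 1`. -/
def MemOmegaB (u₀ : ℝ → ℝ) : Prop :=
  IntervalIntegrable u₀ volume 0 1 ∧ IntervalIntegrable (fun s => u₀ s ^ 2) volume 0 1 ∧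
    2 * Real.exp (L2norm u₀) * L2norm u₀ < 1

/-- The heat evolution `v(t,x) = 1 + Σ_{n≥1} e^{-n²π²t} lₙ(u₀) √2 cos(nπx)`. -/
noncomputable def heatV (u₀ : ℝ → ℝ) (t x : ℝ) : ℝ :=
  1 + ∑' n : ℕ+, Real.exp (-((n : ℕ) : ℝ) ^ 2 * π ^ 2 * t) * lCoef (n : ℕ) u₀ *
    (Real.sqrt 2 * Real.cos (((n : ℕ) : ℝ) * π * x))

/-- The spatial derivative of the heat evolution,
`∂ₓv(t,x) = -Σ_{n≥1} e^{-n²π²t} lₙ(u₀) √2 nπ sin(nπx)`. -/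
noncomputable def heatVx (u₀ : ℝ → ℝ) (t x : ℝ) : ℝ :=
  -∑' n : ℕ+, Real.exp (-((n : ℕ) : ℝ) ^ 2 * π ^ 2 * t) * lCoef (n : ℕ) u₀ *
    (Real.sqrt 2 * ((n : ℕ) : ℝ) * π * Real.sin (((n : ℕ) : ℝ) * π * x))

/-- The Burgers evolution `u(t,x) = -2 ∂ₓv(t,x) / v(t,x)`. -/
noncomputable def burgersU (u₀ : ℝ → ℝ) (t x : ℝ) : ℝ := -2 * heatVx u₀ t x / heatV u₀ t x

/-- The Koopman index set `𝒜`: a tuple `ν = (n₀, n₁, …, n_{α(ν)})` of positive integers,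
encoded as the head `n₀ : ℕ+` together with the (possibly empty) list `(n₁, …, n_{α(ν)})`. -/
abbrev KoopIdx : Type := ℕ+ × List ℕ+

/-- The Koopman eigenvalue `λ_ν = -π² Σ_{k=0}^{α(ν)} n_k²`. -/
noncomputable def lamIdx (ν : KoopIdx) : ℝ :=
  -π ^ 2 * ((((ν.1 : ℕ) : ℝ)) ^ 2 + (ν.2.map (fun k => (((k : ℕ) : ℝ)) ^ 2)).sum)

/-- The Koopman mode
`a_ν(x) = (-1)^{α(ν)} 2^{(α(ν)+3)/2} n₀ π sin(n₀πx) ∏_{k=1}^{α(ν)} cos(n_kπx)`. -/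
noncomputable def aIdx (ν : KoopIdx) (x : ℝ) : ℝ :=
  (-1 : ℝ) ^ ν.2.length * (2 : ℝ) ^ (((ν.2.length : ℝ) + 3) / 2) * ((ν.1 : ℕ) : ℝ) * π *
    Real.sin (((ν.1 : ℕ) : ℝ) * π * x) *
    (ν.2.map (fun k => Real.cos (((k : ℕ) : ℝ) * π * x))).prod

/-- The Koopman eigenfunctional `φ_ν(u₀) = ∏_{k=0}^{α(ν)} l_{n_k}(u₀)`. -/
noncomputable def phiIdx (u₀ : ℝ → ℝ) (ν : KoopIdx) : ℝ :=
  lCoef (ν.1 : ℕ) u₀ * (ν.2.map (fun k => lCoef (k : ℕ) u₀)).prod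

lemma hv_cos_int (k : ℤ) : ∫ s in (0:ℝ)..1, Real.cos (k * π * s) = if k = 0 then 1 else 0 := by
  split_ifs with h
  · simp [h]
  · have hk : (k : ℝ) * π ≠ 0 := mul_ne_zero (by exact_mod_cast h) Real.pi_ne_zero
    rw [intervalIntegral.integral_comp_mul_left (fun x => Real.cos x) hk]
    simp [Real.sin_int_mul_pi]

lemma hv_sin_orth (m n : ℕ+) :
    ∫ s in (0:ℝ)..1, Real.sin ((m : ℕ) * π * s) * Real.sin ((n : ℕ) * π * s)
      = if m = n then 1 / 2 else 0 := by
  have h1 : ∀ s : ℝ, Real.sin ((m : ℕ) * π * s) * Real.sin ((n : ℕ) * π * s)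
      = (1/2) * (Real.cos ((((m : ℕ) : ℤ) - ((n : ℕ) : ℤ) : ℤ) * π * s)
        - Real.cos ((((m : ℕ) : ℤ) + ((n : ℕ) : ℤ) : ℤ) * π * s)) := by
    intro s
    push_cast
    rw [sub_mul, sub_mul, add_mul, add_mul, Real.cos_sub, Real.cos_add]
    ring
  simp_rw [h1]
  rw [intervalIntegral.integral_const_mul, intervalIntegral.integral_sub
    (Continuous.intervalIntegrable (by fun_prop) _ _)
    (Continuous.intervalIntegrable (by fun_prop) _ _), hv_cos_int, hv_cos_int]
  have hm := m.pos
  have hn := n.pos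
  have h2 : ((m : ℕ) : ℤ) + ((n : ℕ) : ℤ) ≠ 0 := by omega
  have h3 : (((m : ℕ) : ℤ) - ((n : ℕ) : ℤ) = 0) ↔ m = n := by
    rw [← PNat.coe_inj]; omega
  rw [if_neg h2]
  by_cases h : m = n
  · rw [if_pos (h3.2 h), if_pos h]; norm_num
  · rw [if_neg (fun hh => h (h3.1 hh)), if_neg h]; norm_num

lemma hv_bessel (g : ℝ → ℝ) (hg : IntervalIntegrable g volume 0 1)
    (hg2 : IntervalIntegrable (fun s => g s ^ 2) volume 0 1) (F : Finset ℕ+) :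
    ∑ n ∈ F, (Real.sqrt 2 * ∫ s in (0:ℝ)..1, g s * Real.sin ((n : ℕ) * π * s)) ^ 2
      ≤ ∫ s in (0:ℝ)..1, g s ^ 2 := by
  set b : ℕ+ → ℝ := fun n => Real.sqrt 2 * ∫ s in (0:ℝ)..1, g s * Real.sin ((n : ℕ) * π * s)
    with hb
  have hs2 : Real.sqrt 2 * Real.sqrt 2 = 2 := Real.mul_self_sqrt (by norm_num)
  set S : ℝ → ℝ := fun s => ∑ n ∈ F, b n * (Real.sqrt 2 * Real.sin ((n : ℕ) * π * s)) with hS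
  have hSc : Continuous S := by
    rw [hS]; fun_prop
  have hgS : IntervalIntegrable (fun s => g s * S s) volume 0 1 :=
    hg.mul_continuousOn hSc.continuousOn
  have hSS : IntervalIntegrable (fun s => S s ^ 2) volume 0 1 :=
    (hSc.pow 2).intervalIntegrable _ _
  have e1 : ∫ s in (0:ℝ)..1, g s * S s = ∑ n ∈ F, b n ^ 2 := by
    have : ∀ s, g s * S s
        = ∑ n ∈ F, (b n * Real.sqrt 2) * (g s * Real.sin ((n : ℕ) * π * s)) := by
      intro s
      simp only [hS, Finset.mul_sum]
      exact Finset.sum_congr rfl fun n _ => by ring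
    simp_rw [this]
    rw [intervalIntegral.integral_finsetSum]
    · refine Finset.sum_congr rfl fun n _ => ?_
      rw [intervalIntegral.integral_const_mul, mul_assoc, sq]
    · intro n _
      exact (hg.mul_continuousOn (by fun_prop)).const_mul _
  have e2 : ∫ s in (0:ℝ)..1, S s ^ 2 = ∑ n ∈ F, b n ^ 2 := by
    have : ∀ s, S s ^ 2 = ∑ n ∈ F, ∑ m ∈ F, (2 * b n * b m) *
        (Real.sin ((n : ℕ) * π * s) * Real.sin ((m : ℕ) * π * s)) := by
      intro s
      simp only [hS, sq, Finset.sum_mul_sum]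
      refine Finset.sum_congr rfl fun n _ => Finset.sum_congr rfl fun m _ => ?_
      linear_combination (b n * b m * Real.sin ((n : ℕ) * π * s) * Real.sin ((m : ℕ) * π * s)) * hs2
    simp_rw [this]
    rw [intervalIntegral.integral_finsetSum]
    · refine Finset.sum_congr rfl fun n hn => ?_
      rw [intervalIntegral.integral_finsetSum]
      · simp_rw [intervalIntegral.integral_const_mul, hv_sin_orth]
        simp only [mul_ite, mul_zero, Finset.sum_ite_eq, hn, if_true]
        ring
      · intro m _
        exact Continuous.intervalIntegrable (by fun_prop) _ _
    · intro n _
      exact Continuous.intervalIntegrable (by fun_prop) _ _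
  have e3 : 0 ≤ ∫ s in (0:ℝ)..1, (g s ^ 2 - 2 * (g s * S s) + S s ^ 2) := by
    apply intervalIntegral.integral_nonneg (by norm_num)
    intro s _
    nlinarith [sq_nonneg (g s - S s)]
  rw [intervalIntegral.integral_add (hg2.sub (hgS.const_mul 2)) hSS,
    intervalIntegral.integral_sub hg2 (hgS.const_mul 2), intervalIntegral.integral_const_mul,
    e1, e2] at e3
  linarith

lemma hv_prim_bound (u : ℝ → ℝ) (hu : IntervalIntegrable u volume 0 1)
    (hu2 : IntervalIntegrable (fun s => u s ^ 2) volume 0 1) (x : ℝ) (hx : x ∈ Icc (0:ℝ) 1) :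
    |∫ s in (0:ℝ)..x, u s| ≤ L2norm u := by
  have h1 : |∫ s in (0:ℝ)..x, u s| ≤ ∫ s in (0:ℝ)..1, |u s| := by
    refine (intervalIntegral.abs_integral_le_integral_abs hx.1).trans ?_
    apply intervalIntegral.integral_mono_interval le_rfl hx.1 hx.2
    · exact Filter.Eventually.of_forall fun s => abs_nonneg _
    · exact hu.abs
  refine h1.trans ?_
  unfold L2norm
  apply Real.le_sqrt_of_sq_le
  set m := ∫ s in (0:ℝ)..1, |u s| with hm
  have e3 : 0 ≤ ∫ s in (0:ℝ)..1, (u s ^ 2 - (2 * m) * |u s| + m ^ 2) := by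
    apply intervalIntegral.integral_nonneg (by norm_num)
    intro s _
    nlinarith [sq_nonneg (|u s| - m), sq_abs (u s)]
  rw [intervalIntegral.integral_add (hu2.sub (hu.abs.const_mul _)) (by simp),
    intervalIntegral.integral_sub hu2 (hu.abs.const_mul _), intervalIntegral.integral_const_mul,
    ← hm] at e3
  simp at e3
  nlinarith

lemma hv_ac_exp (f : ℝ → ℝ) (hf : AbsolutelyContinuousOnInterval f 0 1) :
    AbsolutelyContinuousOnInterval (fun x => Real.exp (f x)) 0 1 := by
  obtain ⟨C, hC⟩ := hf.exists_bound
  obtain ⟨K, hK⟩ := (Real.contDiff_exp (n := 1)).contDiffOn.exists_lipschitzOnWith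
    (s := Icc (-C) C) (by decide) (convex_Icc _ _) isCompact_Icc
  rw [absolutelyContinuousOnInterval_iff] at hf ⊢
  intro ε hε
  obtain ⟨δ, hδ, H⟩ := hf (ε / (K + 1)) (by positivity)
  refine ⟨δ, hδ, fun E hE hs => ?_⟩
  have h1 := H E hE hs
  have h2 : ∑ i ∈ Finset.range E.1, dist (Real.exp (f (E.2 i).1)) (Real.exp (f (E.2 i).2))
      ≤ K * ∑ i ∈ Finset.range E.1, dist (f (E.2 i).1) (f (E.2 i).2) := by
    rw [Finset.mul_sum]
    refine Finset.sum_le_sum fun i hi => ?_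
    have := hE.1 i hi
    exact hK.dist_le_mul _ (abs_le.1 (hC _ this.1)) _ (abs_le.1 (hC _ this.2))
  have h0 : 0 ≤ ∑ i ∈ Finset.range E.1, dist (f (E.2 i).1) (f (E.2 i).2) :=
    Finset.sum_nonneg fun _ _ => dist_nonneg
  rw [lt_div_iff₀ (by positivity)] at h1
  nlinarith

lemma hv_H_ac (u : ℝ → ℝ) (hu : IntervalIntegrable u volume 0 1) :
    AbsolutelyContinuousOnInterval (coleHopfH u) 0 1 := by
  have h1 := hu.absolutelyContinuousOnInterval_intervalIntegral (c := 0) (by simp)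
  have h2 := (hv_ac_exp _ (h1.const_mul (-(1/2)))).const_mul
    (∫ y in (0:ℝ)..1, Real.exp (-(1/2) * ∫ s in (0:ℝ)..y, u s))⁻¹
  unfold coleHopfH
  simpa only [div_eq_inv_mul] using h2

lemma hv_H_deriv (u : ℝ → ℝ) (hu : IntervalIntegrable u volume 0 1) :
    ∀ᵐ x, x ∈ uIcc (0:ℝ) 1 → deriv (coleHopfH u) x = -(1/2) * (u x * coleHopfH u x) := by
  filter_upwards [hu.ae_hasDerivAt_integral] with x hx hx1
  have h1 := (((hx hx1 0 (by simp)).const_mul (-(1/2))).exp).div_const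
    (∫ y in (0:ℝ)..1, Real.exp (-(1/2) * ∫ s in (0:ℝ)..y, u s))
  have h2 : HasDerivAt (coleHopfH u) _ x := h1
  rw [h2.deriv]
  unfold coleHopfH
  ring

lemma hv_lCoef (u : ℝ → ℝ) (hu : IntervalIntegrable u volume 0 1) (n : ℕ+) :
    lCoef n u = (Real.sqrt 2 * ∫ s in (0:ℝ)..1, (u s * coleHopfH u s) * Real.sin ((n : ℕ) * π * s))
      / (2 * (n : ℕ) * π) := by
  have hn : ((n : ℕ) : ℝ) ≠ 0 := by exact_mod_cast n.pos.ne'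
  have hg : AbsolutelyContinuousOnInterval (fun s => Real.sin ((n : ℕ) * π * s)) 0 1 :=
    ContDiffOn.absolutelyContinuousOnInterval (ContDiff.contDiffOn (by fun_prop))
  have h := (hv_H_ac u hu).integral_mul_deriv_eq_deriv_mul hg
  have hd : ∀ s : ℝ, deriv (fun s => Real.sin ((n : ℕ) * π * s)) s
      = ((n : ℕ) * π) * Real.cos ((n : ℕ) * π * s) := by
    intro s
    have := ((hasDerivAt_id s).const_mul (((n : ℕ) : ℝ) * π)).sin
    simp only [id, mul_one] at this
    rw [this.deriv]; ring
  have hI : ∫ x in (0:ℝ)..1, deriv (coleHopfH u) x * Real.sin ((n : ℕ) * π * x)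
      = ∫ x in (0:ℝ)..1, -(1/2) * ((u x * coleHopfH u x) * Real.sin ((n : ℕ) * π * x)) := by
    apply intervalIntegral.integral_congr_ae
    filter_upwards [hv_H_deriv u hu] with x hx hx1
    rw [hx (uIoc_subset_uIcc hx1)]; ring
  rw [hI, intervalIntegral.integral_const_mul] at h
  simp_rw [hd] at h
  have h3 : ∀ s, coleHopfH u s * ((n : ℕ) * π * Real.cos ((n : ℕ) * π * s))
      = ((n : ℕ) * π) * (coleHopfH u s * Real.cos ((n : ℕ) * π * s)) := fun s => by ring
  simp_rw [h3] at h
  rw [intervalIntegral.integral_const_mul] at h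
  simp only [mul_one, mul_zero, Real.sin_nat_mul_pi, Real.sin_zero, sub_zero, zero_sub] at h
  unfold lCoef cCoef
  have hpi := Real.pi_ne_zero
  rw [eq_div_iff (by positivity)]
  linear_combination (2 * Real.sqrt 2) * h

lemma hv_H_bound (u : ℝ → ℝ) (hu : IntervalIntegrable u volume 0 1)
    (hu2 : IntervalIntegrable (fun s => u s ^ 2) volume 0 1) (x : ℝ) (hx : x ∈ Icc (0:ℝ) 1) :
    0 ≤ coleHopfH u x ∧ coleHopfH u x ≤ Real.exp (L2norm u) := by
  have hb := hv_prim_bound u hu hu2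
  have hZ : Real.exp (-(L2norm u / 2))
      ≤ ∫ y in (0:ℝ)..1, Real.exp (-(1/2) * ∫ s in (0:ℝ)..y, u s) := by
    have hc : ContinuousOn (fun y => Real.exp (-(1/2) * ∫ s in (0:ℝ)..y, u s)) (uIcc (0:ℝ) 1) :=
      (hv_ac_exp _ ((hu.absolutelyContinuousOnInterval_intervalIntegral (c := 0)
        (by simp)).const_mul (-(1/2)))).continuousOn
    have := intervalIntegral.integral_mono_on (a := (0:ℝ)) (b := 1) (μ := volume)
      (f := fun _ => Real.exp (-(L2norm u / 2))) (by norm_num) (by simp) hc.intervalIntegrable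
      (fun y hy => Real.exp_le_exp.2 (by have := abs_le.1 (hb y hy); linarith))
    simpa using this
  have hZ0 := (Real.exp_pos _).trans_le hZ
  unfold coleHopfH
  refine ⟨by positivity, ?_⟩
  rw [div_le_iff₀ hZ0]
  calc Real.exp (-(1/2) * ∫ s in (0:ℝ)..x, u s) ≤ Real.exp (L2norm u + -(L2norm u / 2)) :=
        Real.exp_le_exp.2 (by have := abs_le.1 (hb x hx); linarith)
    _ = Real.exp (L2norm u) * Real.exp (-(L2norm u / 2)) := Real.exp_add _ _
    _ ≤ _ := by gcongr

lemma hv_g (u : ℝ → ℝ) (h : MemOmegaB u) :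
    IntervalIntegrable (fun s => u s * coleHopfH u s) volume 0 1 ∧
    IntervalIntegrable (fun s => (u s * coleHopfH u s) ^ 2) volume 0 1 ∧
    ∫ s in (0:ℝ)..1, (u s * coleHopfH u s) ^ 2 ≤ 1 / 4 := by
  obtain ⟨hu, hu2, hN⟩ := h
  have hc := (hv_H_ac u hu).continuousOn
  have i2 : IntervalIntegrable (fun s => (u s * coleHopfH u s) ^ 2) volume 0 1 := by
    simp_rw [mul_pow]
    exact hu2.mul_continuousOn (hc.pow 2)
  refine ⟨hu.mul_continuousOn hc, i2, ?_⟩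
  have h1 : ∫ s in (0:ℝ)..1, (u s * coleHopfH u s) ^ 2
      ≤ ∫ s in (0:ℝ)..1, Real.exp (L2norm u) ^ 2 * u s ^ 2 := by
    refine intervalIntegral.integral_mono_on (by norm_num) i2 (hu2.const_mul _) fun s hs => ?_
    obtain ⟨h0, h1⟩ := hv_H_bound u hu hu2 s hs
    rw [mul_pow, mul_comm]
    gcongr
  rw [intervalIntegral.integral_const_mul] at h1
  have h2 : ∫ s in (0:ℝ)..1, u s ^ 2 = L2norm u ^ 2 := by
    unfold L2norm
    rw [Real.sq_sqrt]
    exact intervalIntegral.integral_nonneg (by norm_num) fun s _ => sq_nonneg _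
  rw [h2] at h1
  have h3 : 0 ≤ Real.exp (L2norm u) * L2norm u :=
    mul_nonneg (Real.exp_pos _).le (Real.sqrt_nonneg _)
  nlinarith

lemma hv_sum (u : ℝ → ℝ) (h : MemOmegaB u) (F : Finset ℕ+) :
    ∑ n ∈ F, Real.sqrt 2 * |lCoef n u| ≤ 1 / 4 := by
  obtain ⟨g1, g2, g3⟩ := hv_g u h
  have hB := (hv_bessel _ g1 g2 F).trans g3
  set b : ℕ+ → ℝ := fun n =>
    Real.sqrt 2 * ∫ s in (0:ℝ)..1, (u s * coleHopfH u s) * Real.sin ((n : ℕ) * π * s) with hb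
  have hz : ∑ n ∈ F, (1:ℝ) / ((n : ℕ) : ℝ) ^ 2 ≤ π ^ 2 / 6 := by
    have := sum_le_hasSum (F.map ⟨fun n : ℕ+ => (n : ℕ), PNat.coe_injective⟩)
      (fun i _ => by positivity) hasSum_zeta_two
    simpa using this
  have hs2 : Real.sqrt 2 ^ 2 = 2 := Real.sq_sqrt (by norm_num)
  have he : ∀ n ∈ F, Real.sqrt 2 * |lCoef n u|
      = (Real.sqrt 2 / (2 * π)) * ((1 / ((n : ℕ) : ℝ)) * |b n|) := by
    intro n _
    have hn : (0:ℝ) < ((n : ℕ) : ℝ) := by exact_mod_cast n.pos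
    rw [hv_lCoef u h.1 n, abs_div, abs_of_pos (show (0:ℝ) < 2 * (n : ℕ) * π by positivity)]
    field_simp
    rfl
  rw [Finset.sum_congr rfl he, ← Finset.mul_sum]
  have hcs := Finset.sum_mul_sq_le_sq_mul_sq F (fun n : ℕ+ => 1 / ((n : ℕ) : ℝ)) (fun n => |b n|)
  simp only [sq_abs, div_pow, one_pow] at hcs
  have hle : (∑ n ∈ F, (1 / ((n : ℕ) : ℝ)) * |b n|) ^ 2 ≤ π ^ 2 / 6 * (1 / 4) :=
    hcs.trans (mul_le_mul hz hB (Finset.sum_nonneg fun _ _ => sq_nonneg _) (by positivity))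
  refine (abs_le_of_sq_le_sq' ?_ (by norm_num)).2
  rw [mul_pow, div_pow, mul_pow, hs2]
  calc 2 / (2 ^ 2 * π ^ 2) * (∑ n ∈ F, (1 / ((n : ℕ) : ℝ)) * |b n|) ^ 2
      ≤ 2 / (2 ^ 2 * π ^ 2) * (π ^ 2 / 6 * (1 / 4)) := by gcongr
    _ = 1 / 48 := by field_simp; norm_num
    _ ≤ _ := by norm_num

/-- For `u₀ ∈ Ω_B`, for every `t ≥ 0` and `x ∈ [0,1]`, the series defining
`v(t,x)` converges absolutely and `|v(t,x) - 1| ≤ 1/4`; in particular `v(t,x) ≥ 3/4 > 0`. -/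
theorem heatV_near_one (u₀ : ℝ → ℝ) (h : MemOmegaB u₀) :
    ∀ t : ℝ, 0 ≤ t → ∀ x ∈ Icc (0:ℝ) 1,
      Summable (fun n : ℕ+ =>
        |Real.exp (-((n : ℕ) : ℝ) ^ 2 * π ^ 2 * t) * lCoef (n : ℕ) u₀ *
          (Real.sqrt 2 * Real.cos (((n : ℕ) : ℝ) * π * x))|) ∧
      |heatV u₀ t x - 1| ≤ 1/4 ∧ 3/4 ≤ heatV u₀ t x := by
  intro t ht x hx
  set f : ℕ+ → ℝ := fun n => Real.exp (-((n : ℕ) : ℝ) ^ 2 * π ^ 2 * t) * lCoef (n : ℕ) u₀ *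
          (Real.sqrt 2 * Real.cos (((n : ℕ) : ℝ) * π * x)) with hf
  have hfb : ∀ n, |f n| ≤ Real.sqrt 2 * |lCoef n u₀| := by
    intro n
    have h1 : Real.exp (-((n : ℕ) : ℝ) ^ 2 * π ^ 2 * t) ≤ 1 := by
      rw [Real.exp_le_one_iff]
      have : 0 ≤ ((n : ℕ) : ℝ) ^ 2 * π ^ 2 * t := by positivity
      linarith
    have h2 := Real.abs_cos_le_one (((n : ℕ) : ℝ) * π * x)
    simp only [hf, abs_mul, Real.abs_exp, abs_of_nonneg (Real.sqrt_nonneg 2)]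
    calc _ ≤ 1 * |lCoef n u₀| * (Real.sqrt 2 * 1) := by gcongr
      _ = _ := by ring
  have hF : ∀ F : Finset ℕ+, ∑ n ∈ F, |f n| ≤ 1 / 4 := fun F =>
    (Finset.sum_le_sum fun n _ => hfb n).trans (hv_sum u₀ h F)
  have hs : Summable (fun n => |f n|) := summable_of_sum_le (fun _ => abs_nonneg _) hF
  have hv : |heatV u₀ t x - 1| ≤ 1 / 4 := by
    have h1 : heatV u₀ t x - 1 = ∑' n, f n := by simp [heatV, hf]
    rw [h1]
    have h2 := norm_tsum_le_tsum_norm (f := f) hs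
    have h3 := Real.tsum_le_of_sum_le (fun _ => abs_nonneg _) hF
    exact h2.trans h3
  refine ⟨hs, hv, ?_⟩
  have := (abs_le.1 hv).1
  linarith
end

section
/- Let u₀ ∈ L²([0,1]) with ‖u₀‖_{L²} < 2√3/e. Then for every t > 0 and every x ∈ [0,1], the family (e^{λ_ν t} |a_ν(x)| |φ_ν(u₀)|)_{ν ∈ 𝒜} is summable, and its sum is at most t^{−1/4} e ‖u₀‖_{L²} / (1 − e‖u₀‖_{L²}/(2√3)). -/
open MeasureTheory Real Set

lemma tsum_fin_prod (b : ℕ+ → ENNReal) (n : ℕ) :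
    ∑' v : Fin n → ℕ+, ∏ i, b (v i) = (∑' k, b k) ^ n := by
  induction n with
  | zero => simp
  | succ n ih =>
    rw [← (Fin.consEquiv (fun _ : Fin (n+1) => ℕ+)).tsum_eq, ENNReal.tsum_prod']
    simp only [Fin.consEquiv_apply, Fin.prod_univ_succ, Fin.cons_zero, Fin.cons_succ]
    simp_rw [ENNReal.tsum_mul_left, ih, ENNReal.tsum_mul_right]
    rw [pow_succ']

lemma tsum_list_prod (b : ℕ+ → ENNReal) :
    ∑' l : List ℕ+, (l.map b).prod = (1 - ∑' k, b k)⁻¹ := by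
  rw [← (List.equivSigmaTuple (α := ℕ+)).symm.tsum_eq, ENNReal.tsum_sigma']
  rw [← ENNReal.tsum_geometric]
  congr 1
  ext n
  rw [← tsum_fin_prod]
  congr 1
  ext v
  simp [List.equivSigmaTuple, List.map_ofFn, List.prod_ofFn]

lemma ofReal_list_prod (b : ℕ+ → ℝ) (hb : ∀ k, 0 ≤ b k) (l : List ℕ+) :
    0 ≤ (l.map b).prod ∧
    ENNReal.ofReal (l.map b).prod = (l.map (fun k => ENNReal.ofReal (b k))).prod := by
  induction l with
  | nil => simp
  | cons k l ih =>
    simp only [List.map_cons, List.prod_cons]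
    exact ⟨mul_nonneg (hb k) ih.1, by rw [ENNReal.ofReal_mul (hb k), ih.2]⟩

lemma tsum_ofReal_le (a : ℕ+ → ℝ) (ha : ∀ k, 0 ≤ a k) (A : ℝ)
    (hA : ∀ F : Finset ℕ+, ∑ k ∈ F, a k ≤ A) :
    ∑' k, ENNReal.ofReal (a k) ≤ ENNReal.ofReal A := by
  rw [ENNReal.tsum_eq_iSup_sum]
  refine iSup_le fun F => ?_
  rw [← ENNReal.ofReal_sum_of_nonneg (fun k _ => ha k)]
  exact ENNReal.ofReal_le_ofReal (hA F)

lemma list_series (a b : ℕ+ → ℝ) (ha : ∀ k, 0 ≤ a k) (hb : ∀ k, 0 ≤ b k) (A B : ℝ)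
    (hA : ∀ F : Finset ℕ+, ∑ k ∈ F, a k ≤ A) (hB : ∀ F : Finset ℕ+, ∑ k ∈ F, b k ≤ B)
    (hB1 : B < 1) :
    Summable (fun ν : ℕ+ × List ℕ+ => a ν.1 * (ν.2.map b).prod) ∧
    (∑' ν : ℕ+ × List ℕ+, a ν.1 * (ν.2.map b).prod) ≤ A / (1 - B) := by
  have hA0 : 0 ≤ A := by simpa using hA ∅
  have hB0 : 0 ≤ B := by simpa using hB ∅
  have hc : 0 ≤ A / (1 - B) := div_nonneg hA0 (by linarith)
  have hnn : ∀ ν : ℕ+ × List ℕ+, 0 ≤ a ν.1 * (ν.2.map b).prod := fun ν =>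
    mul_nonneg (ha _) (ofReal_list_prod b hb _).1
  have key : ∑' ν : ℕ+ × List ℕ+, ENNReal.ofReal (a ν.1 * (ν.2.map b).prod)
      ≤ ENNReal.ofReal (A / (1 - B)) := by
    rw [ENNReal.tsum_prod']
    simp_rw [ENNReal.ofReal_mul (ha _), (ofReal_list_prod b hb _).2, ENNReal.tsum_mul_left,
      tsum_list_prod, ENNReal.tsum_mul_right]
    rw [div_eq_mul_inv, ENNReal.ofReal_mul hA0, ENNReal.ofReal_inv_of_pos (by linarith),
      ENNReal.ofReal_sub _ hB0, ENNReal.ofReal_one]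
    gcongr
    · exact tsum_ofReal_le a ha A hA
    · exact tsum_ofReal_le b hb B hB
  have fin : ∀ s : Finset (ℕ+ × List ℕ+), ∑ ν ∈ s, a ν.1 * (ν.2.map b).prod ≤ A / (1 - B) := by
    intro s
    rw [← ENNReal.ofReal_le_ofReal_iff hc, ENNReal.ofReal_sum_of_nonneg (fun ν _ => hnn ν)]
    exact (ENNReal.sum_le_tsum s).trans key
  exact ⟨summable_of_sum_le hnn fin, Real.tsum_le_of_sum_le hnn fin⟩

lemma gauss_sum (c : ℝ) (hc : 0 < c) (F : Finset ℕ+) :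
    ∑ k ∈ F, Real.exp (-c * ((k : ℕ) : ℝ) ^ 2) ≤ √(π / c) / 2 := by
  have anti : AntitoneOn (fun x : ℝ => Real.exp (-c * x ^ 2)) (Ici 0) := by
    intro x hx y hy hxy
    simp only [mem_Ici] at hx
    simp only
    apply Real.exp_le_exp.2
    have : x ^ 2 ≤ y ^ 2 := by gcongr
    nlinarith
  have integ : IntegrableOn (fun x : ℝ => Real.exp (-c * x ^ 2)) (Ioi 0) :=
    (integrable_exp_neg_mul_sq hc).integrableOn
  have h1 := anti.tsum_add_one_le_integral integ (fun t _ => (Real.exp_pos _).le)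
  have hs := anti.summable_of_integrableOn_Ioi_zero integ (fun t _ => (Real.exp_pos _).le)
  rw [integral_gaussian_Ioi] at h1
  refine le_trans ?_ h1
  have hs' := (summable_nat_add_iff 1).2 hs
  rw [← Equiv.pnatEquivNat.tsum_eq] 
  have hs'' := (Equiv.pnatEquivNat.summable_iff).2 hs'
  have h2 := hs''.sum_le_tsum F (fun _ _ => (Real.exp_pos _).le)
  simp only [Equiv.pnatEquivNat_apply, PNat.natPred_add_one] at h2 ⊢
  exact h2

lemma basel (F : Finset ℕ+) : ∑ k ∈ F, (1 / (((k : ℕ) : ℝ) * π)) ^ 2 ≤ 1 / 6 := by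
  have h := hasSum_zeta_two
  have h1 : ∑ k ∈ F, (1:ℝ) / ((k : ℕ) : ℝ) ^ 2 ≤ π ^ 2 / 6 := by
    rw [← h.tsum_eq]
    have := h.summable.sum_le_tsum (F.map ⟨((↑) : ℕ+ → ℕ), PNat.coe_injective⟩)
      (fun _ _ => by positivity)
    simpa using this
  have h2 : ∑ k ∈ F, (1 / (((k : ℕ) : ℝ) * π)) ^ 2 = (1 / π ^ 2) * ∑ k ∈ F, (1:ℝ) / ((k : ℕ) : ℝ) ^ 2 := by
    rw [Finset.mul_sum]
    refine Finset.sum_congr rfl fun k _ => ?_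
    field_simp
  rw [h2]
  calc _ ≤ (1 / π ^ 2) * (π ^ 2 / 6) := by gcongr
    _ = 1/6 := by field_simp

lemma sin_orth (n m : ℕ+) : ∫ s in (0:ℝ)..1, Real.sin ((n:ℕ) * π * s) * Real.sin ((m:ℕ) * π * s)
    = if n = m then 1/2 else 0 := by
  have hcos : ∀ k : ℤ, k ≠ 0 → ∫ s in (0:ℝ)..1, Real.cos (k * π * s) = 0 := by
    intro k hk
    have : (k * π : ℝ) ≠ 0 := mul_ne_zero (by exact_mod_cast hk) pi_ne_zero
    rw [intervalIntegral.integral_comp_mul_left (fun x => Real.cos x) this]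
    simp [Real.sin_int_mul_pi]
  have e : ∀ s : ℝ, Real.sin ((n:ℕ) * π * s) * Real.sin ((m:ℕ) * π * s) =
      (1/2) * (Real.cos (((n:ℕ) - (m:ℕ) : ℤ) * π * s) - Real.cos (((n:ℕ) + (m:ℕ) : ℤ) * π * s)) := by
    intro s
    push_cast
    rw [show ((n:ℕ) - (m:ℕ) : ℝ) * π * s = (n:ℕ) * π * s - (m:ℕ) * π * s by ring,
      show ((n:ℕ) + (m:ℕ) : ℝ) * π * s = (n:ℕ) * π * s + (m:ℕ) * π * s by ring,
      Real.cos_sub, Real.cos_add]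
    ring
  simp_rw [e]
  rw [intervalIntegral.integral_const_mul, intervalIntegral.integral_sub
    (Continuous.intervalIntegrable (by fun_prop) _ _) (Continuous.intervalIntegrable (by fun_prop) _ _),
    hcos ((n:ℕ) + (m:ℕ) : ℤ) (by have := n.pos; omega)]
  split_ifs with h
  · subst h; simp
  · rw [hcos]
    · simp
    · intro h'
      apply h
      apply PNat.eq
      omega

lemma bessel_sin (f : ℝ → ℝ) (hf : IntervalIntegrable f volume 0 1)
    (hf2 : IntervalIntegrable (fun s => f s ^ 2) volume 0 1) (F : Finset ℕ+) :
    ∑ n ∈ F, (√2 * ∫ s in (0:ℝ)..1, f s * Real.sin ((n:ℕ) * π * s)) ^ 2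
      ≤ ∫ s in (0:ℝ)..1, f s ^ 2 := by
  set b : ℕ+ → ℝ := fun n => ∫ s in (0:ℝ)..1, f s * Real.sin ((n:ℕ) * π * s) with hb
  set g : ℝ → ℝ := fun s => ∑ n ∈ F, 2 * b n * Real.sin ((n:ℕ) * π * s) with hg
  have hgc : Continuous g := by fun_prop
  have h0 : 0 ≤ ∫ s in (0:ℝ)..1, (f s - g s) ^ 2 :=
    intervalIntegral.integral_nonneg (by norm_num) (fun _ _ => sq_nonneg _)
  have hfg : IntervalIntegrable (fun s => f s * g s) volume 0 1 := hf.mul_continuousOn hgc.continuousOn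
  have hfs : ∀ n : ℕ+, IntervalIntegrable (fun s => f s * Real.sin ((n:ℕ) * π * s)) volume 0 1 :=
    fun n => hf.mul_continuousOn (Continuous.continuousOn (by fun_prop))
  have hgg : IntervalIntegrable (fun s => g s * g s) volume 0 1 :=
    (hgc.mul hgc).intervalIntegrable _ _
  have e1 : ∫ s in (0:ℝ)..1, (f s - g s) ^ 2 =
      (∫ s in (0:ℝ)..1, f s ^ 2) - 2 * (∫ s in (0:ℝ)..1, f s * g s) + ∫ s in (0:ℝ)..1, g s * g s := by
    rw [← intervalIntegral.integral_const_mul, ← intervalIntegral.integral_sub hf2 (hfg.const_mul 2),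
      ← intervalIntegral.integral_add (hf2.sub (hfg.const_mul 2)) hgg]
    congr 1; ext s; ring
  have e2 : ∫ s in (0:ℝ)..1, f s * g s = ∑ n ∈ F, 2 * b n ^ 2 := by
    have : ∀ s, f s * g s = ∑ n ∈ F, 2 * b n * (f s * Real.sin ((n:ℕ) * π * s)) := by
      intro s; rw [hg, Finset.mul_sum]; refine Finset.sum_congr rfl fun n _ => by ring
    simp_rw [this]
    rw [intervalIntegral.integral_finsetSum (fun n _ => (hfs n).const_mul _)]
    refine Finset.sum_congr rfl fun n _ => ?_
    rw [intervalIntegral.integral_const_mul]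
    change 2 * b n * b n = _
    ring
  have e3 : ∫ s in (0:ℝ)..1, g s * g s = ∑ n ∈ F, 2 * b n ^ 2 := by
    have : ∀ s, g s * g s = ∑ n ∈ F, ∑ m ∈ F, 4 * b n * b m *
        (Real.sin ((n:ℕ) * π * s) * Real.sin ((m:ℕ) * π * s)) := by
      intro s; rw [hg, Finset.sum_mul_sum]
      refine Finset.sum_congr rfl fun n _ => Finset.sum_congr rfl fun m _ => by ring
    simp_rw [this]
    rw [intervalIntegral.integral_finsetSum (fun n _ => Continuous.intervalIntegrable (by fun_prop) _ _)]
    refine Finset.sum_congr rfl fun n hn => ?_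
    rw [intervalIntegral.integral_finsetSum (fun m _ => Continuous.intervalIntegrable (by fun_prop) _ _)]
    simp_rw [intervalIntegral.integral_const_mul, sin_orth]
    simp [hn]
    ring
  have e4 : ∑ n ∈ F, (√2 * b n) ^ 2 = ∑ n ∈ F, 2 * b n ^ 2 :=
    Finset.sum_congr rfl fun n _ => by rw [mul_pow, Real.sq_sqrt (by norm_num)]
  rw [e4]
  rw [e1, e2, e3] at h0
  linarith

lemma ac_exp_comp (U : ℝ → ℝ) (hU : AbsolutelyContinuousOnInterval U 0 1) :
    AbsolutelyContinuousOnInterval (fun x => Real.exp (U x)) 0 1 := by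
  obtain ⟨C, hC⟩ := hU.exists_bound
  rw [absolutelyContinuousOnInterval_iff] at hU ⊢
  intro ε hε
  have hK : 0 < Real.exp C := Real.exp_pos _
  obtain ⟨δ, hδ, h⟩ := hU (ε / Real.exp C) (by positivity)
  refine ⟨δ, hδ, fun E hE hE2 => ?_⟩
  have h3 := h E hE hE2
  rw [lt_div_iff₀ hK, Finset.sum_mul] at h3
  refine lt_of_le_of_lt (Finset.sum_le_sum fun i hi => ?_) h3
  have lip : ∀ a b : ℝ, a ≤ C → b ≤ C → |Real.exp a - Real.exp b| ≤ |a - b| * Real.exp C := by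
    have aux : ∀ a b : ℝ, a ≤ b → b ≤ C → Real.exp b - Real.exp a ≤ (b - a) * Real.exp C := by
      intro a b hab hb
      have h1 := Real.add_one_le_exp (a - b)
      have h2 : Real.exp a = Real.exp b * Real.exp (a - b) := by rw [← Real.exp_add]; ring_nf
      have h3 : Real.exp b ≤ Real.exp C := Real.exp_le_exp.2 hb
      have h4 := Real.exp_pos b
      nlinarith
    intro a b ha hb
    rcases le_total a b with hab | hab
    · rw [abs_sub_comm, abs_sub_comm a b, abs_of_nonneg (by simpa using hab), abs_of_nonneg (by simpa using hab)]
      exact aux a b hab hb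
    · rw [abs_of_nonneg (by simpa using hab), abs_of_nonneg (by simpa using hab)]
      exact aux b a hab ha
  rw [Real.dist_eq, Real.dist_eq]
  have m1 := (hE.left i hi).left
  have m2 := (hE.left i hi).right
  exact lip _ _ ((le_abs_self _).trans (hC _ m1)) ((le_abs_self _).trans (hC _ m2))

lemma lCoef_eq (u : ℝ → ℝ) (hu : IntervalIntegrable u volume 0 1) (n : ℕ+) :
    ((n:ℕ) * π) * lCoef n u =
      (1/2) * (√2 * ∫ s in (0:ℝ)..1, (u s * coleHopfH u s) * Real.sin ((n:ℕ) * π * s)) := by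
  set D := ∫ y in (0:ℝ)..1, Real.exp (-(1/2) * ∫ s in (0:ℝ)..y, u s) with hD
  have hUac := hu.absolutelyContinuousOnInterval_intervalIntegral (c := 0) (by simp)
  have hEac := ac_exp_comp _ (hUac.const_mul (-(1/2)))
  have hHac : AbsolutelyContinuousOnInterval (coleHopfH u) 0 1 := by
    have := hEac.const_mul (1/D)
    convert this using 1
    ext x
    simp only [coleHopfH]
    ring
  have hn : ((n:ℕ) * π : ℝ) ≠ 0 := by
    have := n.ne_zero
    have := pi_ne_zero
    positivity
  have hS : AbsolutelyContinuousOnInterval (fun s => Real.sin ((n:ℕ) * π * s)) 0 1 :=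
    ContDiffOn.absolutelyContinuousOnInterval (ContDiff.contDiffOn (by fun_prop))
  have ibp := hHac.integral_mul_deriv_eq_deriv_mul hS
  have hd : deriv (fun s : ℝ => Real.sin ((n:ℕ) * π * s)) = fun s => Real.cos ((n:ℕ) * π * s) * ((n:ℕ) * π) := by
    ext s
    have : HasDerivAt (fun s : ℝ => ((n:ℕ) * π * s : ℝ)) ((n:ℕ) * π) s := by
      simpa using (hasDerivAt_id s).const_mul ((n:ℕ) * π : ℝ)
    exact this.sin.deriv
  have hdH : ∫ s in (0:ℝ)..1, deriv (coleHopfH u) s * Real.sin ((n:ℕ) * π * s) =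
      ∫ s in (0:ℝ)..1, (-(1/2)) * ((u s * coleHopfH u s) * Real.sin ((n:ℕ) * π * s)) := by
    apply intervalIntegral.integral_congr_ae
    filter_upwards [hu.ae_hasDerivAt_integral] with x hx hx'
    have h1 := hx (uIoc_subset_uIcc hx') 0 (by simp)
    have h2 : HasDerivAt (coleHopfH u) _ x := ((h1.const_mul (-(1/2))).exp).div_const D
    rw [h2.deriv]
    simp only [coleHopfH, ← hD]
    ring
  rw [hd, hdH, intervalIntegral.integral_const_mul] at ibp
  have e : ∫ s in (0:ℝ)..1, coleHopfH u s * (Real.cos ((n:ℕ) * π * s) * ((n:ℕ) * π)) =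
      (∫ s in (0:ℝ)..1, coleHopfH u s * Real.cos ((n:ℕ) * π * s)) * ((n:ℕ) * π) := by
    rw [← intervalIntegral.integral_mul_const]
    congr 1; ext s; ring
  rw [e] at ibp
  simp only [mul_one, mul_zero, Real.sin_zero, Real.sin_nat_mul_pi] at ibp
  simp only [lCoef, cCoef]
  linear_combination √2 * ibp

lemma H_bound (u : ℝ → ℝ) (hu : IntervalIntegrable u volume 0 1)
    (hu2 : IntervalIntegrable (fun s => u s ^ 2) volume 0 1)
    (hsmall : ∫ s in (0:ℝ)..1, u s ^ 2 ≤ 3) :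
    ContinuousOn (coleHopfH u) (uIcc 0 1) ∧
    ∀ x ∈ Icc (0:ℝ) 1, 0 ≤ coleHopfH u x ∧ coleHopfH u x ≤ Real.exp 1 := by
  have hUac := hu.absolutelyContinuousOnInterval_intervalIntegral (c := 0) (by simp)
  have hUc := hUac.continuousOn
  have hEc : ContinuousOn (fun y => Real.exp (-(1/2) * ∫ s in (0:ℝ)..y, u s)) (uIcc 0 1) :=
    (hUc.const_mul _).rexp
  refine ⟨hEc.div_const _, fun x hx => ?_⟩
  have hle : ∀ y ∈ Icc (0:ℝ) 1, |(∫ s in (0:ℝ)..x, u s) - ∫ s in (0:ℝ)..y, u s| ≤ 2 := by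
    intro y hy
    have hsub : ∀ z ∈ Icc (0:ℝ) 1, IntervalIntegrable u volume 0 z := fun z hz =>
      hu.mono_set (by rw [uIcc_of_le hz.1, uIcc_of_le zero_le_one]; exact Icc_subset_Icc_right hz.2)
    rw [intervalIntegral.integral_interval_sub_left (hsub x hx) (hsub y hy)]
    have h1 : |∫ s in y..x, u s| ≤ abs (∫ s in y..x, |u s|) := by
      simpa only [Real.norm_eq_abs] using
        intervalIntegral.norm_integral_le_abs_integral_norm (f := u) (μ := volume) (a := y) (b := x)
    have h2 : abs (∫ s in y..x, |u s|) ≤ ∫ s in (0:ℝ)..1, |u s| := by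
      have := intervalIntegral.abs_integral_mono_interval (f := fun s => |u s|) (μ := volume)
        (a := y) (b := x) (c := 0) (d := 1) ?_ (Filter.Eventually.of_forall fun s => abs_nonneg _) hu.abs
      · refine this.trans (le_of_eq (abs_of_nonneg ?_))
        exact intervalIntegral.integral_nonneg (by norm_num) (fun _ _ => abs_nonneg _)
      · apply uIoc_subset_uIoc_of_uIcc_subset_uIcc
        apply uIcc_subset_uIcc <;> rw [uIcc_of_le zero_le_one] <;> assumption
    have h3 : ∫ s in (0:ℝ)..1, |u s| ≤ ∫ s in (0:ℝ)..1, (1 + u s ^ 2) / 2 := by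
      apply intervalIntegral.integral_mono_on (by norm_num) hu.abs
        ((intervalIntegrable_const.add hu2).div_const 2)
      intro s _
      nlinarith [sq_nonneg (|u s| - 1), sq_abs (u s)]
    rw [intervalIntegral.integral_div, intervalIntegral.integral_add intervalIntegrable_const hu2] at h3
    simp at h3
    linarith
  have hD : Real.exp (-(1/2) * ∫ s in (0:ℝ)..x, u s) * Real.exp (-1) ≤
      ∫ y in (0:ℝ)..1, Real.exp (-(1/2) * ∫ s in (0:ℝ)..y, u s) := by
    have := intervalIntegral.integral_mono_on (μ := volume) (a := (0:ℝ)) (b := 1)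
      (f := fun _ => Real.exp (-(1/2) * ∫ s in (0:ℝ)..x, u s) * Real.exp (-1)) (by norm_num)
      intervalIntegrable_const hEc.intervalIntegrable (fun y hy => by
        rw [← Real.exp_add]
        apply Real.exp_le_exp.2
        have := (abs_le.1 (hle y hy)).1
        linarith)
    simpa using this
  have hp := Real.exp_pos (-(1/2) * ∫ s in (0:ℝ)..x, u s)
  have hpD : 0 < ∫ y in (0:ℝ)..1, Real.exp (-(1/2) * ∫ s in (0:ℝ)..y, u s) :=
    lt_of_lt_of_le (by positivity) hD
  refine ⟨by unfold coleHopfH; positivity, ?_⟩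
  unfold coleHopfH
  rw [div_le_iff₀ hpD]
  calc _ = Real.exp 1 * (Real.exp (-(1/2) * ∫ s in (0:ℝ)..x, u s) * Real.exp (-1)) := by
        rw [← Real.exp_add, ← Real.exp_add]; ring_nf
    _ ≤ _ := by gcongr

lemma lCoef_sq_sum (u : ℝ → ℝ) (hu : IntervalIntegrable u volume 0 1)
    (hu2 : IntervalIntegrable (fun s => u s ^ 2) volume 0 1)
    (hsmall : ∫ s in (0:ℝ)..1, u s ^ 2 ≤ 3) (F : Finset ℕ+) :
    ∑ n ∈ F, (((n:ℕ) * π) * |lCoef n u|) ^ 2 ≤ (Real.exp 1 * L2norm u / 2) ^ 2 := by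
  obtain ⟨hc, hb⟩ := H_bound u hu hu2 hsmall
  have i2 : IntervalIntegrable (fun s => (u s * coleHopfH u s) ^ 2) volume 0 1 := by
    simp_rw [mul_pow]
    exact hu2.mul_continuousOn (hc.pow 2)
  have h1 := bessel_sin (fun s => u s * coleHopfH u s) (hu.mul_continuousOn hc) i2 F
  have h2 : ∫ s in (0:ℝ)..1, (u s * coleHopfH u s) ^ 2 ≤ ∫ s in (0:ℝ)..1, Real.exp 1 ^ 2 * u s ^ 2 := by
    apply intervalIntegral.integral_mono_on (by norm_num) i2 (hu2.const_mul _)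
    intro s hs
    have := hb s hs
    rw [mul_pow, mul_comm]
    gcongr
    · exact this.1
    · exact this.2
  rw [intervalIntegral.integral_const_mul] at h2
  have h3 : L2norm u ^ 2 = ∫ s in (0:ℝ)..1, u s ^ 2 :=
    Real.sq_sqrt (intervalIntegral.integral_nonneg (by norm_num) (fun _ _ => sq_nonneg _))
  have h4 : ∑ n ∈ F, (((n:ℕ) * π) * |lCoef n u|) ^ 2 =
      (1/4) * ∑ n ∈ F, (√2 * ∫ s in (0:ℝ)..1, (u s * coleHopfH u s) * Real.sin ((n:ℕ) * π * s)) ^ 2 := by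
    rw [Finset.mul_sum]
    refine Finset.sum_congr rfl fun n _ => ?_
    rw [mul_pow, sq_abs, ← mul_pow, lCoef_eq u hu n]
    ring
  rw [h4, div_pow, mul_pow, h3]
  linarith

lemma cs_sum (F : Finset ℕ+) (f g : ℕ+ → ℝ) (P Q : ℝ) (hP : 0 ≤ P) (hQ : 0 ≤ Q)
    (hf : ∑ n ∈ F, f n ^ 2 ≤ P ^ 2) (hg : ∑ n ∈ F, g n ^ 2 ≤ Q ^ 2) :
    ∑ n ∈ F, f n * g n ≤ P * Q := by
  apply le_of_sq_le_sq _ (by positivity)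
  calc _ ≤ (∑ n ∈ F, f n ^ 2) * ∑ n ∈ F, g n ^ 2 := Finset.sum_mul_sq_le_sq_mul_sq _ _ _
    _ ≤ P ^ 2 * Q ^ 2 := by
      gcongr
    _ = _ := by ring

lemma list_coe_map (l : List ℕ+) (f : ℕ → ℝ) :
    (List.map f do
      let a ← l
      pure (a : ℕ)) = l.map (fun k : ℕ+ => f k) := by
  induction l with
  | nil => rfl
  | cons k l ih =>
    simp only [List.map_cons, ← ih]
    simp

lemma list_term (t x : ℝ) (u : ℝ → ℝ) (l : List ℕ+) :
    Real.exp (-π ^ 2 * (l.map (fun k : ℕ+ => (((k : ℕ) : ℝ)) ^ 2)).sum * t) * √2 ^ l.length *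
      |(l.map (fun k : ℕ+ => Real.cos (((k : ℕ) : ℝ) * π * x))).prod| *
      |(l.map (fun k : ℕ+ => lCoef (k : ℕ) u)).prod| =
    (l.map (fun k : ℕ+ => √2 * (((((k:ℕ):ℝ) * π) * |lCoef k u|) * (1 / (((k:ℕ):ℝ) * π))) *
      (Real.exp (-π ^ 2 * ((k:ℕ):ℝ) ^ 2 * t) * |Real.cos (((k : ℕ) : ℝ) * π * x)|))).prod := by
  induction l with
  | nil => simp
  | cons k l ih =>
    simp only [List.map_cons, List.prod_cons, List.sum_cons, List.length_cons, abs_mul]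
    rw [← ih, mul_add, add_mul, Real.exp_add, pow_succ]
    have hk : ((k:ℕ):ℝ) ≠ 0 := by exact_mod_cast k.ne_zero
    field_simp
    ring

theorem koopman_series_abs_bound (u₀ : ℝ → ℝ)
    (hu_int : IntervalIntegrable u₀ volume 0 1)
    (hu_sq : IntervalIntegrable (fun s => u₀ s ^ 2) volume 0 1)
    (hsmall : L2norm u₀ < 2 * Real.sqrt 3 / Real.exp 1) :
    ∀ t : ℝ, 0 < t → ∀ x ∈ Icc (0:ℝ) 1,
      Summable (fun ν : KoopIdx => Real.exp (lamIdx ν * t) * |aIdx ν x| * |phiIdx u₀ ν|) ∧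
      (∑' ν : KoopIdx, Real.exp (lamIdx ν * t) * |aIdx ν x| * |phiIdx u₀ ν|) ≤
        t ^ (-(1/4) : ℝ) * Real.exp 1 * L2norm u₀ /
          (1 - Real.exp 1 * L2norm u₀ / (2 * Real.sqrt 3)) := by
  intro t ht x hx
  have hN : 0 ≤ L2norm u₀ := Real.sqrt_nonneg _
  have h3 : L2norm u₀ ^ 2 = ∫ s in (0:ℝ)..1, u₀ s ^ 2 :=
    Real.sq_sqrt (intervalIntegral.integral_nonneg (by norm_num) (fun _ _ => sq_nonneg _))
  have he : 2 < Real.exp 1 := by have := Real.exp_one_gt_d9; linarith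
  have hs3 : 0 < √3 := by positivity
  have hle3 : ∫ s in (0:ℝ)..1, u₀ s ^ 2 ≤ 3 := by
    rw [← h3]
    have : L2norm u₀ ≤ √3 := by
      refine hsmall.le.trans ?_
      rw [div_le_iff₀ (by positivity)]
      nlinarith
    calc L2norm u₀ ^ 2 ≤ √3 ^ 2 := by gcongr
      _ = 3 := Real.sq_sqrt (by norm_num)
  have hL := lCoef_sq_sum u₀ hu_int hu_sq hle3
  set P := Real.exp 1 * L2norm u₀ / 2 with hP
  have hP0 : 0 ≤ P := by positivity
  let a : ℕ+ → ℝ := fun k => 2 * √2 * (((((k:ℕ):ℝ) * π) * |lCoef k u₀|) *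
    Real.exp (-π ^ 2 * ((k:ℕ):ℝ) ^ 2 * t)) * |Real.sin (((k : ℕ) : ℝ) * π * x)|
  let b : ℕ+ → ℝ := fun k => √2 * (((((k:ℕ):ℝ) * π) * |lCoef k u₀|) * (1 / (((k:ℕ):ℝ) * π))) *
      (Real.exp (-π ^ 2 * ((k:ℕ):ℝ) ^ 2 * t) * |Real.cos (((k : ℕ) : ℝ) * π * x)|)
  have ha : ∀ k, 0 ≤ a k := fun k => by positivity
  have hb : ∀ k, 0 ≤ b k := fun k => by positivity
  have hA : ∀ F : Finset ℕ+, ∑ k ∈ F, a k ≤ t ^ (-(1/4) : ℝ) * Real.exp 1 * L2norm u₀ := by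
    intro F
    have hQ : ∑ k ∈ F, Real.exp (-π ^ 2 * ((k:ℕ):ℝ) ^ 2 * t) ^ 2 ≤ (t ^ (-(1/4) : ℝ) / √2) ^ 2 := by
      have h := gauss_sum (2 * π ^ 2 * t) (by positivity) F
      have e1 : ∀ k : ℕ+, Real.exp (-π ^ 2 * ((k:ℕ):ℝ) ^ 2 * t) ^ 2 =
          Real.exp (-(2 * π ^ 2 * t) * ((k:ℕ):ℝ) ^ 2) := by
        intro k; rw [sq (Real.exp _), ← Real.exp_add]; ring_nf
      simp_rw [e1]
      refine h.trans ?_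
      have e2 : (t ^ (-(1/4) : ℝ) / √2) ^ 2 = √(1 / t) / 2 := by
        rw [div_pow, Real.sq_sqrt (by norm_num), ← Real.rpow_natCast, ← Real.rpow_mul ht.le,
          Real.sqrt_eq_rpow, one_div t, ← Real.rpow_neg_one t, ← Real.rpow_mul ht.le]
        norm_num
      rw [e2]
      gcongr ?_ / 2
      apply Real.sqrt_le_sqrt
      rw [div_le_div_iff₀ (by positivity) ht]
      have := Real.pi_gt_three
      nlinarith [mul_pos Real.pi_pos ht]
    have hcs := cs_sum F (fun k : ℕ+ => ((k:ℕ):ℝ) * π * |lCoef k u₀|)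
      (fun k : ℕ+ => Real.exp (-π ^ 2 * ((k:ℕ):ℝ) ^ 2 * t)) P _ hP0 (by positivity) (hL F) hQ
    calc ∑ k ∈ F, a k ≤ ∑ k ∈ F, 2 * √2 * (((((k:ℕ):ℝ) * π) * |lCoef k u₀|) *
            Real.exp (-π ^ 2 * ((k:ℕ):ℝ) ^ 2 * t)) := by
          refine Finset.sum_le_sum fun k _ => ?_
          exact mul_le_of_le_one_right (by positivity) (Real.abs_sin_le_one _)
      _ ≤ 2 * √2 * (P * (t ^ (-(1/4) : ℝ) / √2)) := by
          rw [← Finset.mul_sum]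
          gcongr
      _ = _ := by rw [hP]; field_simp
  have hB : ∀ F : Finset ℕ+, ∑ k ∈ F, b k ≤ Real.exp 1 * L2norm u₀ / (2 * √3) := by
    intro F
    have hcs := cs_sum F (fun k : ℕ+ => ((k:ℕ):ℝ) * π * |lCoef k u₀|)
      (fun k : ℕ+ => 1 / (((k:ℕ):ℝ) * π)) P (1 / √6) hP0 (by positivity) (hL F)
      (by rw [div_pow, Real.sq_sqrt (by norm_num), one_pow]; exact basel F)
    calc ∑ k ∈ F, b k ≤ ∑ k ∈ F, √2 * (((((k:ℕ):ℝ) * π) * |lCoef k u₀|) * (1 / (((k:ℕ):ℝ) * π))) := by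
          refine Finset.sum_le_sum fun k _ => ?_
          refine mul_le_of_le_one_right (by positivity) ?_
          refine mul_le_one₀ ?_ (abs_nonneg _) (Real.abs_cos_le_one _)
          rw [Real.exp_le_one_iff]
          have : 0 ≤ π ^ 2 * ((k:ℕ):ℝ) ^ 2 * t := by positivity
          linarith
      _ ≤ √2 * (P * (1 / √6)) := by
          rw [← Finset.mul_sum]
          gcongr
      _ = _ := by
          rw [hP, show (6:ℝ) = 2 * 3 by norm_num, Real.sqrt_mul (by norm_num)]
          field_simp
  have hB1 : Real.exp 1 * L2norm u₀ / (2 * √3) < 1 := by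
    rw [div_lt_one (by positivity)]
    rw [lt_div_iff₀ (by positivity)] at hsmall
    linarith
  have hterm : (fun ν : KoopIdx => Real.exp (lamIdx ν * t) * |aIdx ν x| * |phiIdx u₀ ν|) =
      fun ν : KoopIdx => a ν.1 * (ν.2.map b).prod := by
    ext ⟨k, l⟩
    have h := list_term t x u₀ l
    change _ = a k * (l.map b).prod
    rw [show (l.map b).prod = _ from h.symm]
    have e2 : (2:ℝ) ^ (((l.length : ℝ) + 3) / 2) = 2 * √2 * √2 ^ l.length := by
      have : (2:ℝ) ^ (((l.length : ℝ) + 3) / 2) = √2 ^ (l.length + 3) := by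
        rw [Real.sqrt_eq_rpow, ← Real.rpow_natCast, ← Real.rpow_mul (by norm_num)]
        push_cast
        ring_nf
      rw [this, pow_add, pow_succ √2 2, Real.sq_sqrt (by norm_num)]
      ring
    simp only [lamIdx, aIdx, phiIdx, a, list_coe_map, abs_mul, abs_pow, abs_neg, abs_one, one_pow, e2]
    rw [mul_add, add_mul, Real.exp_add]
    simp only [abs_of_pos Real.pi_pos, Nat.abs_cast, abs_of_nonneg (Real.sqrt_nonneg 2), Nat.abs_ofNat]
    ring
  rw [hterm]
  exact list_series a b ha hb _ _ hA hB hB1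
end

section
/- Let u₀ ∈ ω_B. Then for every x ∈ [0,1], the family (|a_ν(x)| |φ_ν(u₀)|)_{ν ∈ 𝒜} is summable and its sum is at most (3 e β₂/(√2 π)) ‖∂ₓu₀‖_{L²} / (1 − β₂ e ‖u₀‖_{L²}/(√2 π)), where β₂ = π/√6. In particular, for every t ≥ 0, Σ_{ν ∈ 𝒜} e^{λ_ν t} |a_ν(x)| |φ_ν(u₀)| is bounded by the same constant, uniformly in t ≥ 0 and x ∈ [0,1]. -/
open MeasureTheory Real Set

lemma kb_bessel (f : ℝ → ℝ) (e : ℕ+ → ℝ → ℝ) (hf : IntervalIntegrable f volume 0 1)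
    (hf2 : IntervalIntegrable (fun s => f s ^ 2) volume 0 1) (he : ∀ n, Continuous (e n))
    (hon : ∀ m n, ∫ s in (0:ℝ)..1, e m s * e n s = if m = n then 1 else 0) (s : Finset ℕ+) :
    ∑ n ∈ s, (∫ x in (0:ℝ)..1, f x * e n x) ^ 2 ≤ ∫ x in (0:ℝ)..1, f x ^ 2 := by
  set c : ℕ+ → ℝ := fun n => ∫ x in (0:ℝ)..1, f x * e n x with hc
  set g : ℝ → ℝ := fun x => ∑ n ∈ s, c n * e n x with hg
  have hgc : Continuous g := by
    rw [hg]; exact continuous_finsetSum _ (fun n _ => continuous_const.mul (he n))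
  have hfg : IntervalIntegrable (fun x => f x * g x) volume 0 1 :=
    hf.mul_continuousOn hgc.continuousOn
  have hgg : IntervalIntegrable (fun x => g x ^ 2) volume 0 1 :=
    (hgc.pow 2).intervalIntegrable _ _
  have h1 : ∫ x in (0:ℝ)..1, f x * g x = ∑ n ∈ s, c n ^ 2 := by
    simp only [hg, Finset.mul_sum]
    rw [intervalIntegral.integral_finsetSum]
    · refine Finset.sum_congr rfl fun n _ => ?_
      have : ∀ x, f x * (c n * e n x) = c n * (f x * e n x) := fun x => by ring
      simp only [this, intervalIntegral.integral_const_mul]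
      rw [sq]
    · intro n _
      exact hf.mul_continuousOn (continuous_const.mul (he n)).continuousOn
  have h2 : ∫ x in (0:ℝ)..1, g x ^ 2 = ∑ n ∈ s, c n ^ 2 := by
    have : ∀ x, g x ^ 2 = ∑ n ∈ s, ∑ m ∈ s, (c n * c m) * (e n x * e m x) := by
      intro x
      simp only [hg, sq, Finset.sum_mul_sum]
      refine Finset.sum_congr rfl fun n _ => Finset.sum_congr rfl fun m _ => by ring
    simp only [this]
    rw [intervalIntegral.integral_finsetSum]
    · refine Finset.sum_congr rfl fun n hn => ?_
      rw [intervalIntegral.integral_finsetSum]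
      · simp only [intervalIntegral.integral_const_mul, hon]
        simp [hn, sq]
      · intro m _
        exact (continuous_const.mul ((he n).mul (he m))).intervalIntegrable _ _
    · intro n _
      exact (continuous_finsetSum _ (fun m _ => 
        continuous_const.mul ((he n).mul (he m)))).intervalIntegrable _ _
  have h3 : 0 ≤ ∫ x in (0:ℝ)..1, (f x - g x) ^ 2 :=
    intervalIntegral.integral_nonneg (by norm_num) (fun x _ => sq_nonneg _)
  have h4 : ∫ x in (0:ℝ)..1, (f x - g x) ^ 2 =
      (∫ x in (0:ℝ)..1, f x ^ 2) - 2 * (∫ x in (0:ℝ)..1, f x * g x) 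
        + ∫ x in (0:ℝ)..1, g x ^ 2 := by
    rw [← intervalIntegral.integral_const_mul, ← intervalIntegral.integral_sub hf2 (hfg.const_mul 2),
      ← intervalIntegral.integral_add (hf2.sub (hfg.const_mul 2)) hgg]
    congr 1; ext x; ring
  rw [h4, h1, h2] at h3
  linarith

lemma kb_sum_inv (s : Finset ℕ+) : ∑ n ∈ s, (1 / ((n:ℕ):ℝ)) ^ 2 ≤ π ^ 2 / 6 := by
  have h := sum_le_hasSum (s.map ⟨fun n : ℕ+ => (n:ℕ), PNat.coe_injective⟩)
    (fun i _ => by positivity) hasSum_zeta_two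
  simpa [Finset.sum_map] using h

/-- Cauchy-Schwarz plus Bessel. -/
lemma kb_sum (f : ℝ → ℝ) (e : ℕ+ → ℝ → ℝ) (hf : IntervalIntegrable f volume 0 1)
    (hf2 : IntervalIntegrable (fun s => f s ^ 2) volume 0 1) (he : ∀ n, Continuous (e n))
    (hon : ∀ m n, ∫ s in (0:ℝ)..1, e m s * e n s = if m = n then 1 else 0) (s : Finset ℕ+) :
    ∑ n ∈ s, |∫ x in (0:ℝ)..1, f x * e n x| * (1 / ((n:ℕ):ℝ)) ≤ (π / √6) * L2norm f := by
  refine (Real.sum_mul_le_sqrt_mul_sqrt s _ _).trans ?_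
  rw [mul_comm (π / √6)]
  have h1 : √(π ^ 2 / 6) = π / √6 := by
    rw [Real.sqrt_div (by positivity), Real.sqrt_sq pi_pos.le]
  rw [← h1]
  refine mul_le_mul ?_ (Real.sqrt_le_sqrt (kb_sum_inv s)) (by positivity) (Real.sqrt_nonneg _)
  refine Real.sqrt_le_sqrt ?_
  simp only [sq_abs]
  exact kb_bessel f e hf hf2 he hon s

lemma kb_int_cos (k : ℤ) (hk : k ≠ 0) : ∫ s in (0:ℝ)..1, Real.cos (k * π * s) = 0 := by
  have hk' : (k:ℝ) * π ≠ 0 := mul_ne_zero (by exact_mod_cast hk) pi_ne_zero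
  rw [intervalIntegral.integral_comp_mul_left (fun x => Real.cos x) hk']
  simp

lemma kb_on_cos (m n : ℕ+) : ∫ s in (0:ℝ)..1, (√2 * Real.cos (((m:ℕ):ℝ) * π * s)) *
    (√2 * Real.cos (((n:ℕ):ℝ) * π * s)) = if m = n then 1 else 0 := by
  have h2 : √2 * √2 = (2:ℝ) := Real.mul_self_sqrt (by norm_num)
  have : ∀ s : ℝ, (√2 * Real.cos (((m:ℕ):ℝ) * π * s)) * (√2 * Real.cos (((n:ℕ):ℝ) * π * s))
      = Real.cos ((((m:ℕ):ℤ) - ((n:ℕ):ℤ) : ℤ) * π * s) + 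
        Real.cos ((((m:ℕ):ℤ) + ((n:ℕ):ℤ) : ℤ) * π * s) := by
    intro s
    push_cast
    rw [sub_mul, sub_mul, add_mul, add_mul, Real.cos_sub, Real.cos_add]
    linear_combination (Real.cos (((m:ℕ):ℝ) * π * s) * Real.cos (((n:ℕ):ℝ) * π * s)) * h2
  simp only [this]
  rw [intervalIntegral.integral_add (Continuous.intervalIntegrable (by fun_prop) _ _)
    (Continuous.intervalIntegrable (by fun_prop) _ _), kb_int_cos (((m:ℕ):ℤ) + ((n:ℕ):ℤ))
    (by have := m.pos; omega)]
  split_ifs with h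
  · subst h; simp
  · rw [kb_int_cos]
    · simp
    · intro h'; apply h; exact PNat.coe_injective (by omega)

lemma kb_on_sin (m n : ℕ+) : ∫ s in (0:ℝ)..1, (√2 * Real.sin (((m:ℕ):ℝ) * π * s)) *
    (√2 * Real.sin (((n:ℕ):ℝ) * π * s)) = if m = n then 1 else 0 := by
  have h2 : √2 * √2 = (2:ℝ) := Real.mul_self_sqrt (by norm_num)
  have : ∀ s : ℝ, (√2 * Real.sin (((m:ℕ):ℝ) * π * s)) * (√2 * Real.sin (((n:ℕ):ℝ) * π * s))
      = Real.cos ((((m:ℕ):ℤ) - ((n:ℕ):ℤ) : ℤ) * π * s) - 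
        Real.cos ((((m:ℕ):ℤ) + ((n:ℕ):ℤ) : ℤ) * π * s) := by
    intro s
    push_cast
    rw [sub_mul, sub_mul, add_mul, add_mul, Real.cos_sub, Real.cos_add]
    linear_combination (Real.sin (((m:ℕ):ℝ) * π * s) * Real.sin (((n:ℕ):ℝ) * π * s)) * h2
  simp only [this]
  rw [intervalIntegral.integral_sub (Continuous.intervalIntegrable (by fun_prop) _ _)
    (Continuous.intervalIntegrable (by fun_prop) _ _), kb_int_cos (((m:ℕ):ℤ) + ((n:ℕ):ℤ))
    (by have := m.pos; omega)]
  split_ifs with h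
  · subst h; simp
  · rw [kb_int_cos]
    · simp
    · intro h'; apply h; exact PNat.coe_injective (by omega)

lemma kb_abs_int_le (w : ℝ → ℝ) (hw : IntervalIntegrable w volume 0 1)
    (hw2 : IntervalIntegrable (fun s => w s ^ 2) volume 0 1) (x : ℝ) (hx : x ∈ Icc (0:ℝ) 1) :
    |∫ s in (0:ℝ)..x, w s| ≤ L2norm w := by
  have hsub : uIcc 0 x ⊆ uIcc (0:ℝ) 1 := by
    rw [uIcc_of_le hx.1, uIcc_of_le zero_le_one]; exact Icc_subset_Icc_right hx.2
  have hw' := hw.mono_set hsub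
  have hw2' := hw2.mono_set hsub
  apply Real.abs_le_sqrt
  set c := ∫ s in (0:ℝ)..x, w s with hc
  have h3 : 0 ≤ ∫ s in (0:ℝ)..x, (w s - c) ^ 2 :=
    intervalIntegral.integral_nonneg hx.1 (fun x _ => sq_nonneg _)
  have h4 : ∫ s in (0:ℝ)..x, (w s - c) ^ 2 = 
      (∫ s in (0:ℝ)..x, w s ^ 2) - 2 * c * c + x * c ^ 2 := by
    have : ∀ s, (w s - c) ^ 2 = w s ^ 2 - (2 * c) * w s + c ^ 2 := fun s => by ring
    simp only [this]
    rw [intervalIntegral.integral_add (hw2'.sub (hw'.const_mul _)) (by simp),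
      intervalIntegral.integral_sub hw2' (hw'.const_mul _), intervalIntegral.integral_const_mul]
    simp [hc]
  have h5 : ∫ s in (0:ℝ)..x, w s ^ 2 ≤ ∫ s in (0:ℝ)..1, w s ^ 2 :=
    intervalIntegral.integral_mono_interval le_rfl hx.1 hx.2
      (Filter.Eventually.of_forall fun s => sq_nonneg _) hw2
  rw [h4] at h3
  nlinarith [sq_nonneg c, hx.2]

lemma kb_ibp (w du g g' : ℝ → ℝ) (hdu : IntervalIntegrable du volume 0 1)
    (hw : ∀ x ∈ Icc (0:ℝ) 1, w x = ∫ s in (0:ℝ)..x, du s) (hw1 : w 1 = 0)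
    (hg : ∀ x, HasDerivAt g (g' x) x) (hg' : Continuous g') :
    ∫ x in (0:ℝ)..1, w x * g' x = - ∫ x in (0:ℝ)..1, du x * g x := by
  have h01 : (0:ℝ) ≤ 1 := zero_le_one
  have hI : IntervalIntegrable g' volume 0 1 := hg'.intervalIntegrable _ _
  have ac1 := hdu.absolutelyContinuousOnInterval_intervalIntegral (c := 0) (by simp)
  have ac2 := hI.absolutelyContinuousOnInterval_intervalIntegral (c := 0) (by simp)
  have key := ac1.integral_mul_deriv_eq_deriv_mul ac2
  have e1 : ∫ s in (0:ℝ)..1, du s = 0 := by rw [← hw 1 (by simp), hw1]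
  have e2 : ∀ x, ∫ s in (0:ℝ)..x, g' s = g x - g 0 := fun x =>
    intervalIntegral.integral_eq_sub_of_hasDerivAt (fun y _ => hg y) (hg'.intervalIntegrable _ _)
  have hd : ∀ x, deriv (fun x => g x - g 0) x = g' x := fun x => ((hg x).sub_const _).deriv
  simp only [e1, e2, hd] at key
  have l : ∫ x in (0:ℝ)..1, w x * g' x = ∫ x in (0:ℝ)..1, (∫ s in (0:ℝ)..x, du s) * g' x := by
    refine intervalIntegral.integral_congr fun x hx => ?_
    rw [uIcc_of_le h01] at hx
    simp only [hw x hx]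
  have r : ∫ x in (0:ℝ)..1, deriv (fun x => ∫ s in (0:ℝ)..x, du s) x * (g x - g 0) = 
      ∫ x in (0:ℝ)..1, du x * (g x - g 0) := by
    refine intervalIntegral.integral_congr_ae ?_
    filter_upwards [hdu.ae_hasDerivAt_integral] with x hx hx'
    rw [(hx (uIoc_subset_uIcc hx') 0 (by simp)).deriv]
  have gc : Continuous g := continuous_iff_continuousAt.2 fun x => (hg x).continuousAt
  rw [l, key, r]
  simp only [mul_sub]
  rw [intervalIntegral.integral_sub (hdu.mul_continuousOn gc.continuousOn) (hdu.mul_const _),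
    intervalIntegral.integral_mul_const, e1]
  simp

lemma kb_tsum_tuple (g : ℕ+ → ENNReal) (n : ℕ) :
    ∑' v : Fin n → ℕ+, ((List.ofFn v).map g).prod = (∑' k, g k) ^ n := by
  induction n with
  | zero => simp
  | succ n ih =>
    rw [← (Fin.consEquiv (fun _ : Fin (n+1) => ℕ+)).tsum_eq, ENNReal.tsum_prod']
    simp [Fin.consEquiv, List.ofFn_succ, ENNReal.tsum_mul_left, ENNReal.tsum_mul_right, pow_succ', ← ih, List.map_ofFn, Function.comp_def]

lemma kb_tsum_list (g : ℕ+ → ENNReal) :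
    ∑' l : List ℕ+, (l.map g).prod = (1 - ∑' k, g k)⁻¹ := by
  rw [← ENNReal.tsum_geometric, ← (List.equivSigmaTuple (α := ℕ+)).symm.tsum_eq, ENNReal.tsum_sigma']
  refine tsum_congr fun n => ?_
  rw [← kb_tsum_tuple]
  rfl

lemma kb_H_deriv (w : ℝ → ℝ) (hw : Continuous w) (x : ℝ) :
    HasDerivAt (coleHopfH w) (-(1/2) * w x * coleHopfH w x) x := by
  have h1 : HasDerivAt (fun x => ∫ s in (0:ℝ)..x, w s) (w x) x :=
    hw.integral_hasStrictDerivAt 0 x |>.hasDerivAt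
  have h2 := ((h1.const_mul (-(1/2))).exp).div_const
    (∫ y in (0:ℝ)..1, Real.exp (-(1/2) * ∫ s in (0:ℝ)..y, w s))
  refine h2.congr_deriv ?_
  unfold coleHopfH
  ring

lemma kb_H_cont (w : ℝ → ℝ) (hw : Continuous w) : Continuous (coleHopfH w) :=
  continuous_iff_continuousAt.2 fun x => (kb_H_deriv w hw x).continuousAt

lemma kb_H_bound (w : ℝ → ℝ) (hw : Continuous w) (x : ℝ) (hx : x ∈ Icc (0:ℝ) 1) :
    0 ≤ coleHopfH w x ∧ coleHopfH w x ≤ Real.exp (L2norm w) := by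
  have hb : ∀ y ∈ Icc (0:ℝ) 1, |∫ s in (0:ℝ)..y, w s| ≤ L2norm w := fun y hy =>
    kb_abs_int_le w (hw.intervalIntegrable _ _) ((hw.pow 2).intervalIntegrable _ _) y hy
  have hPc : Continuous (fun x => ∫ s in (0:ℝ)..x, w s) :=
    intervalIntegral.continuous_primitive (fun a b => hw.intervalIntegrable a b) 0
  have hZ : Real.exp (-(L2norm w / 2)) ≤ 
      ∫ y in (0:ℝ)..1, Real.exp (-(1/2) * ∫ s in (0:ℝ)..y, w s) := by
    have : ∫ y in (0:ℝ)..1, Real.exp (-(L2norm w / 2)) ≤ 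
        ∫ y in (0:ℝ)..1, Real.exp (-(1/2) * ∫ s in (0:ℝ)..y, w s) := by
      refine intervalIntegral.integral_mono_on zero_le_one (by simp)
        (Continuous.intervalIntegrable (by fun_prop) _ _) ?_
      intro y hy
      apply Real.exp_le_exp.2
      have := (abs_le.1 (hb y hy)).2
      linarith
    simpa using this
  have hZ0 := (Real.exp_pos _).trans_le hZ
  refine ⟨div_nonneg (Real.exp_pos _).le hZ0.le, ?_⟩
  unfold coleHopfH
  rw [div_le_iff₀ hZ0]
  calc Real.exp (-(1/2) * ∫ s in (0:ℝ)..x, w s) ≤ Real.exp (L2norm w / 2) := by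
        apply Real.exp_le_exp.2
        have := (abs_le.1 (hb x hx)).1
        linarith
    _ = Real.exp (L2norm w) * Real.exp (-(L2norm w / 2)) := by
        rw [← Real.exp_add]; congr 1; ring
    _ ≤ _ := by gcongr

/-- First derivative of the Cole-Hopf transform. -/
noncomputable def kbP (w : ℝ → ℝ) : ℝ → ℝ := fun x => -(1/2) * w x * coleHopfH w x

/-- Second (weak) derivative of the Cole-Hopf transform. -/
noncomputable def kbR (w du : ℝ → ℝ) : ℝ → ℝ := fun x =>
  du x * (-(1/2) * coleHopfH w x) + (1/4) * w x ^ 2 * coleHopfH w x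

lemma kb_P_cont (w : ℝ → ℝ) (hw : Continuous w) : Continuous (kbP w) := by
  have := kb_H_cont w hw
  unfold kbP; fun_prop

lemma kb_l1 (w : ℝ → ℝ) (hw : Continuous w) (n : ℕ+) :
    lCoef n w * (((n:ℕ):ℝ) * π) = 
      - ∫ x in (0:ℝ)..1, kbP w x * (√2 * Real.sin (((n:ℕ):ℝ) * π * x)) := by
  have hn : ((n:ℕ):ℝ) * π ≠ 0 := mul_ne_zero (by exact_mod_cast n.ne_zero) pi_ne_zero
  have hs : ∀ x, HasDerivAt (fun x => Real.sin (((n:ℕ):ℝ) * π * x)) 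
      (Real.cos (((n:ℕ):ℝ) * π * x) * (((n:ℕ):ℝ) * π)) x := by
    intro x
    simpa using ((hasDerivAt_id x).const_mul (((n:ℕ):ℝ) * π)).sin
  have key := intervalIntegral.integral_mul_deriv_eq_deriv_mul (a := 0) (b := 1)
    (fun x _ => kb_H_deriv w hw x) (fun x _ => hs x)
    ((kb_P_cont w hw).intervalIntegrable _ _) (Continuous.intervalIntegrable (by fun_prop) _ _)
  have e1 : ∀ x, kbP w x * (√2 * Real.sin (((n:ℕ):ℝ) * π * x)) = 
    √2 * (-(1/2) * w x * coleHopfH w x * Real.sin (((n:ℕ):ℝ) * π * x)) := fun x => by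
      unfold kbP; ring
  have e2 : ∀ x, coleHopfH w x * (Real.cos (((n:ℕ):ℝ) * π * x) * (((n:ℕ):ℝ) * π)) = 
    (((n:ℕ):ℝ) * π) * (coleHopfH w x * Real.cos (((n:ℕ):ℝ) * π * x)) := fun x => by ring
  simp only [e2, intervalIntegral.integral_const_mul, mul_one, mul_zero, Real.sin_nat_mul_pi,
    Real.sin_zero, sub_zero, zero_sub] at key
  simp only [e1, intervalIntegral.integral_const_mul]
  unfold lCoef cCoef
  linear_combination √2 * key

lemma kb_l2 (w du : ℝ → ℝ) (hw : Continuous w) (hdu : IntervalIntegrable du volume 0 1)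
    (hwd : ∀ x ∈ Icc (0:ℝ) 1, w x = ∫ s in (0:ℝ)..x, du s) (hw1 : w 1 = 0) (n : ℕ+) :
    (∫ x in (0:ℝ)..1, kbP w x * (√2 * Real.sin (((n:ℕ):ℝ) * π * x))) * (((n:ℕ):ℝ) * π) = 
      ∫ x in (0:ℝ)..1, kbR w du x * (√2 * Real.cos (((n:ℕ):ℝ) * π * x)) := by
  have hHc := kb_H_cont w hw
  have hPc := kb_P_cont w hw
  have hs : ∀ x, HasDerivAt (fun x => Real.cos (((n:ℕ):ℝ) * π * x)) 
      (-Real.sin (((n:ℕ):ℝ) * π * x) * (((n:ℕ):ℝ) * π)) x := by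
    intro x
    simpa using ((hasDerivAt_id x).const_mul (((n:ℕ):ℝ) * π)).cos
  have key := kb_ibp w du _ _ hdu hwd hw1 (fun x => (kb_H_deriv w hw x).mul (hs x)) (by fun_prop)
  simp only [Pi.mul_apply] at key
  have i1 : IntervalIntegrable (fun x => w x * kbP w x * Real.cos (((n:ℕ):ℝ) * π * x)) volume 0 1 :=
    Continuous.intervalIntegrable (by fun_prop) _ _
  have i2 : IntervalIntegrable (fun x => (((n:ℕ):ℝ) * π) * (w x * coleHopfH w x * 
      Real.sin (((n:ℕ):ℝ) * π * x))) volume 0 1 :=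
    Continuous.intervalIntegrable (by fun_prop) _ _
  have i3 : IntervalIntegrable (fun x => du x * (coleHopfH w x * 
      Real.cos (((n:ℕ):ℝ) * π * x))) volume 0 1 :=
    hdu.mul_continuousOn (Continuous.continuousOn (by fun_prop))
  have e0 : ∀ x, w x * (-(1 / 2) * w x * coleHopfH w x * Real.cos (((n:ℕ):ℝ) * π * x) + 
      coleHopfH w x * (-Real.sin (((n:ℕ):ℝ) * π * x) * (((n:ℕ):ℝ) * π))) = 
      w x * kbP w x * Real.cos (((n:ℕ):ℝ) * π * x) - (((n:ℕ):ℝ) * π) * (w x * coleHopfH w x * 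
      Real.sin (((n:ℕ):ℝ) * π * x)) := fun x => by unfold kbP; ring
  simp only [e0] at key
  rw [intervalIntegral.integral_sub i1 i2, intervalIntegral.integral_const_mul] at key
  have e1 : ∀ x, kbP w x * (√2 * Real.sin (((n:ℕ):ℝ) * π * x)) = 
    (-(1/2) * √2) * (w x * coleHopfH w x * Real.sin (((n:ℕ):ℝ) * π * x)) := fun x => by
      unfold kbP; ring
  have e2 : ∀ x, kbR w du x * (√2 * Real.cos (((n:ℕ):ℝ) * π * x)) = 
    (-(1/2) * √2) * (w x * kbP w x * Real.cos (((n:ℕ):ℝ) * π * x) +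
      du x * (coleHopfH w x * Real.cos (((n:ℕ):ℝ) * π * x))) := fun x => by
      unfold kbR kbP; ring
  simp only [e1, e2, intervalIntegral.integral_const_mul]
  rw [intervalIntegral.integral_add i1 i3]
  linear_combination (1/2) * √2 * key

lemma kb_L2_nonneg (f : ℝ → ℝ) : 0 ≤ L2norm f := Real.sqrt_nonneg _

lemma kb_L2_sq (f : ℝ → ℝ) : L2norm f ^ 2 = ∫ s in (0:ℝ)..1, f s ^ 2 :=
  Real.sq_sqrt (intervalIntegral.integral_nonneg zero_le_one (fun x _ => sq_nonneg _))

lemma kb_P_norm (w : ℝ → ℝ) (hw : Continuous w) (hU : L2norm w ≤ 1 / 2) :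
    L2norm (kbP w) ≤ 1/2 * Real.exp 1 * L2norm w := by
  have hU0 := kb_L2_nonneg w
  refine Real.sqrt_le_iff.2 ⟨by positivity, ?_⟩
  rw [mul_pow, kb_L2_sq, ← intervalIntegral.integral_const_mul]
  refine intervalIntegral.integral_mono_on zero_le_one 
    (((kb_P_cont w hw).pow 2).intervalIntegrable _ _)
    ((continuous_const.mul (hw.pow 2)).intervalIntegrable _ _) ?_
  intro x hx
  obtain ⟨h0, h1⟩ := kb_H_bound w hw x hx
  have h2 : coleHopfH w x ≤ Real.exp 1 := h1.trans (Real.exp_le_exp.2 (by linarith))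
  have h3 : coleHopfH w x ^ 2 ≤ Real.exp 1 ^ 2 := by gcongr
  have : kbP w x ^ 2 = (1/4) * w x ^ 2 * coleHopfH w x ^ 2 := by unfold kbP; ring
  rw [this]
  nlinarith [mul_le_mul_of_nonneg_left h3 (sq_nonneg (w x))]

lemma kb_R_int (w du : ℝ → ℝ) (hw : Continuous w) (hdu : IntervalIntegrable du volume 0 1)
    (hdu2 : IntervalIntegrable (fun s => du s ^ 2) volume 0 1) : 
    IntervalIntegrable (kbR w du) volume 0 1 ∧ 
    IntervalIntegrable (fun x => kbR w du x ^ 2) volume 0 1 := by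
  have hHc := kb_H_cont w hw
  constructor
  · exact (hdu.mul_continuousOn (Continuous.continuousOn (by fun_prop))).add
      (Continuous.intervalIntegrable (by fun_prop) _ _)
  · have : (fun x => kbR w du x ^ 2) = fun x => du x ^ 2 * ((1/4) * coleHopfH w x ^ 2) + 
      du x * (-(1/4) * coleHopfH w x * w x ^ 2 * coleHopfH w x) + 
        (1/16) * w x ^ 4 * coleHopfH w x ^ 2 := by
      ext x; unfold kbR; ring
    rw [this]
    exact ((hdu2.mul_continuousOn (Continuous.continuousOn (by fun_prop))).add
      (hdu.mul_continuousOn (Continuous.continuousOn (by fun_prop)))).add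
      (Continuous.intervalIntegrable (by fun_prop) _ _)

lemma kb_R_norm (w du : ℝ → ℝ) (hw : Continuous w) (hU : L2norm w ≤ 1 / 2)
    (hdu : IntervalIntegrable du volume 0 1)
    (hdu2 : IntervalIntegrable (fun s => du s ^ 2) volume 0 1)
    (hwd : ∀ x ∈ Icc (0:ℝ) 1, w x = ∫ s in (0:ℝ)..x, du s) :
    L2norm (kbR w du) ≤ 3/4 * Real.exp 1 * L2norm du := by
  have hU0 := kb_L2_nonneg w
  have hD0 := kb_L2_nonneg du
  set D := L2norm du with hD
  have hw2 : IntervalIntegrable (fun s => w s ^ 2) volume 0 1 := (hw.pow 2).intervalIntegrable _ _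
  refine Real.sqrt_le_iff.2 ⟨by positivity, ?_⟩
  have step : ∫ s in (0:ℝ)..1, kbR w du s ^ 2 ≤ 
      ∫ s in (0:ℝ)..1, (Real.exp 1 * (1/2) * du s ^ 2 + Real.exp 1 * (1/8) * D ^ 2 * w s ^ 2) := by
    refine intervalIntegral.integral_mono_on zero_le_one (kb_R_int w du hw hdu hdu2).2
      ((hdu2.const_mul _).add (hw2.const_mul _)) ?_
    intro x hx
    obtain ⟨h0, h1⟩ := kb_H_bound w hw x hx
    have h3 : coleHopfH w x ^ 2 ≤ Real.exp 1 := by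
      calc coleHopfH w x ^ 2 ≤ Real.exp (L2norm w) ^ 2 := by gcongr
        _ = Real.exp (2 * L2norm w) := by rw [← Real.exp_nat_mul]; norm_num
        _ ≤ _ := Real.exp_le_exp.2 (by linarith)
    have hwx : |w x| ≤ D := by rw [hwd x hx]; exact kb_abs_int_le du hdu hdu2 x hx
    have hwx2 : w x ^ 2 ≤ D ^ 2 := sq_le_sq' (abs_le.1 hwx).1 (abs_le.1 hwx).2
    have hA : (-(1/2) * du x + (1/4) * w x ^ 2) ^ 2 ≤ (1/2) * du x ^ 2 + (1/8) * D ^ 2 * w x ^ 2 := by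
      nlinarith [sq_nonneg ((1/2) * du x + (1/4) * w x ^ 2), 
        mul_le_mul_of_nonneg_right hwx2 (sq_nonneg (w x))]
    have : kbR w du x ^ 2 = (-(1/2) * du x + (1/4) * w x ^ 2) ^ 2 * coleHopfH w x ^ 2 := by
      unfold kbR; ring
    rw [this]
    calc _ ≤ ((1/2) * du x ^ 2 + (1/8) * D ^ 2 * w x ^ 2) * Real.exp 1 := by gcongr
      _ = _ := by ring
  refine step.trans ?_
  rw [intervalIntegral.integral_add (hdu2.const_mul _) (hw2.const_mul _),
    intervalIntegral.integral_const_mul, intervalIntegral.integral_const_mul, ← kb_L2_sq,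
    ← kb_L2_sq, ← hD]
  have he : 2 ≤ Real.exp 1 := by have := Real.add_one_le_exp 1; linarith
  have hU2 : L2norm w ^ 2 ≤ 1 := by nlinarith
  have h1 : Real.exp 1 * (1/8) * D ^ 2 * L2norm w ^ 2 ≤ Real.exp 1 * (1/8) * D ^ 2 * 1 := by gcongr
  have h2 : 0 ≤ Real.exp 1 * D ^ 2 * (Real.exp 1 - 2) := by
    have : 0 ≤ Real.exp 1 - 2 := by linarith
    positivity
  have h3 : 0 ≤ Real.exp 1 * D ^ 2 := by positivity
  nlinarith

lemma kb_sum_l (w : ℝ → ℝ) (hw : Continuous w) (hU : L2norm w ≤ 1 / 2) (s : Finset ℕ+) :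
    ∑ n ∈ s, √2 * |lCoef n w| ≤ (π / √6) * Real.exp 1 * L2norm w / (√2 * π) := by
  have h := kb_sum (kbP w) (fun n x => √2 * Real.sin (((n:ℕ):ℝ) * π * x))
    ((kb_P_cont w hw).intervalIntegrable _ _) (((kb_P_cont w hw).pow 2).intervalIntegrable _ _)
    (fun n => by fun_prop) kb_on_sin s
  have h' : ∑ n ∈ s, |lCoef n w| * π ≤ (π / √6) * (1/2 * Real.exp 1 * L2norm w) := by
    refine le_trans (le_of_eq ?_) (h.trans (by gcongr; exact kb_P_norm w hw hU))
    refine Finset.sum_congr rfl fun n _ => ?_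
    have hn : (0:ℝ) < (n:ℕ) := by exact_mod_cast n.pos
    have := congrArg abs (kb_l1 w hw n)
    rw [abs_neg, abs_mul, abs_of_pos (mul_pos hn pi_pos)] at this
    rw [← this]; field_simp
  rw [← Finset.sum_mul] at h'
  rw [← Finset.mul_sum, le_div_iff₀ (by positivity)]
  have h2 : √2 * √2 = (2:ℝ) := Real.mul_self_sqrt (by norm_num)
  calc √2 * (∑ n ∈ s, |lCoef n w|) * (√2 * π) = (√2 * √2) * ((∑ n ∈ s, |lCoef n w|) * π) := by ring
    _ ≤ 2 * ((π / √6) * (1/2 * Real.exp 1 * L2norm w)) := by rw [h2]; gcongr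
    _ = _ := by ring

lemma kb_sum_nl (w du : ℝ → ℝ) (hw : Continuous w) (hU : L2norm w ≤ 1 / 2) 
    (hdu : IntervalIntegrable du volume 0 1)
    (hdu2 : IntervalIntegrable (fun s => du s ^ 2) volume 0 1)
    (hwd : ∀ x ∈ Icc (0:ℝ) 1, w x = ∫ s in (0:ℝ)..x, du s) (hw1 : w 1 = 0) (s : Finset ℕ+) :
    ∑ n ∈ s, 2 * √2 * ((n:ℕ):ℝ) * π * |lCoef n w| ≤ 
      3 * Real.exp 1 * (π / √6) / (√2 * π) * L2norm du := by
  have h := kb_sum (kbR w du) (fun n x => √2 * Real.cos (((n:ℕ):ℝ) * π * x))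
    (kb_R_int w du hw hdu hdu2).1 (kb_R_int w du hw hdu hdu2).2
    (fun n => by fun_prop) kb_on_cos s
  have h' : ∑ n ∈ s, (((n:ℕ):ℝ) * π * |lCoef n w|) * π ≤ 
      (π / √6) * (3/4 * Real.exp 1 * L2norm du) := by
    refine le_trans (le_of_eq ?_) (h.trans (by gcongr; exact kb_R_norm w du hw hU hdu hdu2 hwd))
    refine Finset.sum_congr rfl fun n _ => ?_
    have hn : (0:ℝ) < (n:ℕ) := by exact_mod_cast n.pos
    have e := kb_l2 w du hw hdu hwd hw1 n
    rw [← neg_eq_iff_eq_neg.2 (kb_l1 w hw n)] at e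
    have := congrArg abs e
    rw [abs_mul, abs_neg, abs_mul, abs_of_pos (mul_pos hn pi_pos)] at this
    rw [← this]; field_simp
  rw [← Finset.sum_mul] at h'
  have h2 : √2 * √2 = (2:ℝ) := Real.mul_self_sqrt (by norm_num)
  have e : ∑ n ∈ s, 2 * √2 * ((n:ℕ):ℝ) * π * |lCoef n w| = 
      2 * √2 * ∑ n ∈ s, (((n:ℕ):ℝ) * π * |lCoef n w|) := by
    rw [Finset.mul_sum]; exact Finset.sum_congr rfl fun n _ => by ring
  rw [e, div_mul_eq_mul_div, le_div_iff₀ (by positivity)]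
  calc 2 * √2 * (∑ n ∈ s, (((n:ℕ):ℝ) * π * |lCoef n w|)) * (√2 * π) 
      = 2 * (√2 * √2) * ((∑ n ∈ s, (((n:ℕ):ℝ) * π * |lCoef n w|)) * π) := by ring
    _ ≤ 2 * 2 * ((π / √6) * (3/4 * Real.exp 1 * L2norm du)) := by rw [h2]; gcongr
    _ = _ := by ring

lemma kb_ofReal_tsum_le (f : ℕ+ → ℝ) (A : ℝ) (hf : ∀ n, 0 ≤ f n)
    (hA : ∀ s : Finset ℕ+, ∑ n ∈ s, f n ≤ A) : ∑' n, ENNReal.ofReal (f n) ≤ ENNReal.ofReal A := by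
  rw [ENNReal.tsum_eq_iSup_sum]
  refine iSup_le fun s => ?_
  rw [← ENNReal.ofReal_sum_of_nonneg (fun n _ => hf n)]
  exact ENNReal.ofReal_le_ofReal (hA s)

lemma kb_ofReal_prod (G : ℕ+ → ℝ) (hG0 : ∀ n, 0 ≤ G n) (l : List ℕ+) :
    0 ≤ (l.map G).prod ∧
      ENNReal.ofReal (l.map G).prod = (l.map (fun n => ENNReal.ofReal (G n))).prod := by
  induction l with
  | nil => simp
  | cons a l ih =>
    simp only [List.map_cons, List.prod_cons]
    exact ⟨mul_nonneg (hG0 a) ih.1, by rw [ENNReal.ofReal_mul (hG0 a), ih.2]⟩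

lemma kb_koop (F G : ℕ+ → ℝ) (A q : ℝ) (hF0 : ∀ n, 0 ≤ F n) (hG0 : ∀ n, 0 ≤ G n)
    (hA0 : 0 ≤ A) (hq : q < 1)
    (hF : ∀ s : Finset ℕ+, ∑ n ∈ s, F n ≤ A) (hG : ∀ s : Finset ℕ+, ∑ n ∈ s, G n ≤ q) :
    Summable (fun ν : KoopIdx => F ν.1 * (ν.2.map G).prod) ∧
      ∑' ν : KoopIdx, F ν.1 * (ν.2.map G).prod ≤ A / (1 - q) := by
  have hq0 : 0 ≤ q := by simpa using hG ∅
  have h0 : ∀ ν : KoopIdx, 0 ≤ F ν.1 * (ν.2.map G).prod := fun ν =>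
    mul_nonneg (hF0 _) (kb_ofReal_prod G hG0 ν.2).1
  have key : ∑' ν : KoopIdx, ENNReal.ofReal (F ν.1 * (ν.2.map G).prod) ≤ 
      ENNReal.ofReal (A / (1 - q)) := by
    have e : ∀ ν : KoopIdx, ENNReal.ofReal (F ν.1 * (ν.2.map G).prod) =
        ENNReal.ofReal (F ν.1) * (ν.2.map (fun n => ENNReal.ofReal (G n))).prod := fun ν => by
      rw [ENNReal.ofReal_mul (hF0 _), (kb_ofReal_prod G hG0 ν.2).2]
    simp only [e]
    rw [ENNReal.tsum_prod']
    simp only [ENNReal.tsum_mul_left, ENNReal.tsum_mul_right, kb_tsum_list]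
    rw [div_eq_mul_inv, ENNReal.ofReal_mul hA0, ENNReal.ofReal_inv_of_pos (by linarith),
      ENNReal.ofReal_sub _ hq0, ENNReal.ofReal_one]
    gcongr
    · exact kb_ofReal_tsum_le F A hF0 hF
    · exact kb_ofReal_tsum_le G q hG0 hG
  have fin : ∀ s : Finset KoopIdx, ∑ ν ∈ s, F ν.1 * (ν.2.map G).prod ≤ A / (1 - q) := by
    intro s
    rw [← ENNReal.ofReal_le_ofReal_iff (div_nonneg hA0 (by linarith)),
      ENNReal.ofReal_sum_of_nonneg (fun ν _ => h0 ν)]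
    exact (ENNReal.sum_le_tsum s).trans key
  have hS := summable_of_sum_le h0 fin
  exact ⟨hS, hS.tsum_le_of_sum_le fin⟩

lemma kb_term_list (u₀ : ℝ → ℝ) (l : List ℕ+) (x : ℝ) :
    √2 ^ l.length * |(l.map (fun k : ℕ+ => Real.cos (((k : ℕ) : ℝ) * π * x))).prod| * 
      |(l.map (fun k : ℕ+ => lCoef (k : ℕ) u₀)).prod| ≤ 
      (l.map (fun n : ℕ+ => √2 * |lCoef n u₀|)).prod := by
  induction l with
  | nil => simp
  | cons a l ih =>
    simp only [List.map_cons, List.prod_cons, List.length_cons, abs_mul, pow_succ]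
    have h1 := Real.abs_cos_le_one (((a : ℕ) : ℝ) * π * x)
    have h2 : √2 * |lCoef a u₀| * |Real.cos (((a : ℕ) : ℝ) * π * x)| ≤ √2 * |lCoef a u₀| :=
      mul_le_of_le_one_right (by positivity) h1
    refine le_trans (le_of_eq ?_) (mul_le_mul h2 ih (by positivity) (by positivity))
    ring

lemma kb_coe_map (l : List ℕ+) (f : ℕ → ℝ) :
    List.map f (do let a ← l; pure (a : ℕ)) = l.map (fun k : ℕ+ => f (k : ℕ)) := by
  induction l with
  | nil => rfl
  | cons a l ih => simpa using ih

lemma kb_term (u₀ : ℝ → ℝ) (ν : KoopIdx) (x : ℝ) :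
    |aIdx ν x| * |phiIdx u₀ ν| ≤ (2 * √2 * ((ν.1:ℕ):ℝ) * π * |lCoef ν.1 u₀|) * 
        (ν.2.map (fun n : ℕ+ => √2 * |lCoef n u₀|)).prod := by
  have hpow : (2:ℝ) ^ (((ν.2.length : ℝ) + 3) / 2) = 2 * √2 * √2 ^ ν.2.length := by
    have h2 : √2 * √2 = (2:ℝ) := Real.mul_self_sqrt (by norm_num)
    have : ((ν.2.length : ℝ) + 3) / 2 = (1/2) * ((ν.2.length + 3 : ℕ) : ℝ) := by push_cast; ring
    rw [this, Real.rpow_mul (by norm_num), ← Real.sqrt_eq_rpow, Real.rpow_natCast, pow_add]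
    linear_combination √2 * √2 ^ ν.2.length * h2
  unfold aIdx phiIdx
  rw [hpow, kb_coe_map, kb_coe_map]
  have hp : |π| = π := abs_of_pos pi_pos
  simp only [abs_mul, abs_pow, abs_neg, abs_one, one_pow, one_mul, hp, Nat.abs_cast, 
    abs_of_nonneg (Real.sqrt_nonneg 2), abs_two]
  have h1 := Real.abs_sin_le_one (((ν.1 : ℕ) : ℝ) * π * x)
  have h2 : 2 * √2 * ((ν.1:ℕ):ℝ) * π * |lCoef ν.1 u₀| * |Real.sin (((ν.1 : ℕ) : ℝ) * π * x)| ≤ 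
      2 * √2 * ((ν.1:ℕ):ℝ) * π * |lCoef ν.1 u₀| :=
    mul_le_of_le_one_right (by positivity) h1
  refine le_trans (le_of_eq ?_) (mul_le_mul h2 (kb_term_list u₀ ν.2 x) 
    (by positivity) (by positivity))
  ring

/-- For `u₀ ∈ ω_B` (i.e. `u₀ ∈ Ω_B` absolutely continuous with weak
derivative `du ∈ L²([0,1])` and `u₀(0) = u₀(1) = 0`) and every `x ∈ [0,1]`, the family
`(|a_ν(x)| |φ_ν(u₀)|)_ν` is summable with sum at most
`(3 e β₂/(√2 π)) ‖du‖ / (1 - β₂ e ‖u₀‖/(√2 π))` where `β₂ = π/√6`; in particular for every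
`t ≥ 0` the sum `Σ_ν e^{λ_ν t} |a_ν(x)| |φ_ν(u₀)|` obeys the same bound, uniformly in `t, x`. -/
theorem koopman_series_abs_bound_regular (u₀ du : ℝ → ℝ) (h : MemOmegaB u₀)
    (hdu_int : IntervalIntegrable du volume 0 1)
    (hdu_sq : IntervalIntegrable (fun s => du s ^ 2) volume 0 1)
    (hAC : ∀ x ∈ Icc (0:ℝ) 1, u₀ x = u₀ 0 + ∫ s in (0:ℝ)..x, du s)
    (hb0 : u₀ 0 = 0) (hb1 : u₀ 1 = 0) :
    ∀ x ∈ Icc (0:ℝ) 1,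
      (Summable (fun ν : KoopIdx => |aIdx ν x| * |phiIdx u₀ ν|) ∧
        (∑' ν : KoopIdx, |aIdx ν x| * |phiIdx u₀ ν|) ≤
          3 * Real.exp 1 * (π / Real.sqrt 6) / (Real.sqrt 2 * π) * L2norm du /
            (1 - (π / Real.sqrt 6) * Real.exp 1 * L2norm u₀ / (Real.sqrt 2 * π))) ∧
      ∀ t : ℝ, 0 ≤ t →
        (∑' ν : KoopIdx, Real.exp (lamIdx ν * t) * |aIdx ν x| * |phiIdx u₀ ν|) ≤
          3 * Real.exp 1 * (π / Real.sqrt 6) / (Real.sqrt 2 * π) * L2norm du /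
            (1 - (π / Real.sqrt 6) * Real.exp 1 * L2norm u₀ / (Real.sqrt 2 * π)) := by
  intro x hx
  have hU : L2norm u₀ ≤ 1 / 2 := by
    have h1 := h.2.2
    have h2 := Real.one_le_exp (kb_L2_nonneg u₀)
    nlinarith [kb_L2_nonneg u₀]
  have hwd : ∀ x ∈ Icc (0:ℝ) 1, u₀ x = ∫ s in (0:ℝ)..x, du s := by
    intro x hx; rw [hAC x hx, hb0, zero_add]
  have hcont : ContinuousOn u₀ (Icc 0 1) := by
    have := (hdu_int.absolutelyContinuousOnInterval_intervalIntegral (c := 0) (by simp)).continuousOn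
    rw [uIcc_of_le zero_le_one] at this
    exact this.congr hwd
  set w : ℝ → ℝ := IccExtend (zero_le_one (α := ℝ)) ((Icc (0:ℝ) 1).domRestrict u₀) with hw
  have hwc : Continuous w := (continuousOn_iff_continuous_domRestrict.1 hcont).Icc_extend'
  have hwu : ∀ x ∈ Icc (0:ℝ) 1, w x = u₀ x := fun x hx => by
    rw [hw, IccExtend_of_mem _ _ hx]; rfl
  have hL : L2norm u₀ = L2norm w := by
    unfold L2norm
    congr 1
    refine intervalIntegral.integral_congr fun y hy => ?_
    rw [uIcc_of_le zero_le_one] at hy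
    simp only [hwu y hy]
  have hl : ∀ n, lCoef n u₀ = lCoef n w := by
    intro n
    have hp : ∀ x ∈ Icc (0:ℝ) 1, ∫ s in (0:ℝ)..x, u₀ s = ∫ s in (0:ℝ)..x, w s := by
      intro x hx
      refine intervalIntegral.integral_congr fun y hy => ?_
      rw [uIcc_of_le hx.1] at hy
      simp only [hwu y ⟨hy.1, hy.2.trans hx.2⟩]
    have hz : ∫ y in (0:ℝ)..1, Real.exp (-(1/2) * ∫ s in (0:ℝ)..y, u₀ s) =
        ∫ y in (0:ℝ)..1, Real.exp (-(1/2) * ∫ s in (0:ℝ)..y, w s) := by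
      refine intervalIntegral.integral_congr fun y hy => ?_
      rw [uIcc_of_le zero_le_one] at hy
      simp only [hp y hy]
    unfold lCoef cCoef
    congr 1
    refine intervalIntegral.integral_congr fun y hy => ?_
    rw [uIcc_of_le zero_le_one] at hy
    simp only [coleHopfH, hz, hp y hy]
  rw [hL] at hU
  have hG := kb_sum_l w hwc hU
  have hF := kb_sum_nl w du hwc hU hdu_int hdu_sq (fun x hx => by rw [hwu x hx, hwd x hx])
    (by rw [hwu 1 (by simp), hb1])
  have hq : (π / √6) * Real.exp 1 * L2norm w / (√2 * π) < 1 := by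
    have h6 : (2:ℝ) ≤ √6 := Real.le_sqrt_of_sq_le (by norm_num)
    have h2 : (1:ℝ) ≤ √2 := Real.le_sqrt_of_sq_le (by norm_num)
    have he : Real.exp 1 < 3 := by have := Real.exp_one_lt_d9; linarith
    have hU0 := kb_L2_nonneg w
    rw [div_lt_one (by positivity)]
    have hp : 0 < π := pi_pos
    calc (π / √6) * Real.exp 1 * L2norm w ≤ (π / 2) * 3 * (1/2) := by gcongr
      _ < 1 * π := by linarith
      _ ≤ √2 * π := by gcongr
  have hA0 : 0 ≤ 3 * Real.exp 1 * (π / √6) / (√2 * π) * L2norm du := by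
    have := kb_L2_nonneg du
    positivity
  have main := kb_koop (fun n => 2 * √2 * ((n:ℕ):ℝ) * π * |lCoef n w|) (fun n => √2 * |lCoef n w|)
    _ _ (fun n => by positivity) (fun n => by positivity) hA0 hq hF hG
  rw [hL]
  have hle : ∀ ν : KoopIdx, |aIdx ν x| * |phiIdx u₀ ν| ≤ 
      (2 * √2 * ((ν.1:ℕ):ℝ) * π * |lCoef ν.1 w|) * 
        (ν.2.map (fun n : ℕ+ => √2 * |lCoef n w|)).prod := fun ν => by
    have := kb_term u₀ ν x
    simp only [hl] at this
    exact this
  have hS : Summable (fun ν : KoopIdx => |aIdx ν x| * |phiIdx u₀ ν|) :=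
    Summable.of_nonneg_of_le (fun ν => by positivity) hle main.1
  have hB := (hS.tsum_le_tsum hle main.1).trans main.2
  refine ⟨⟨hS, hB⟩, fun t ht => ?_⟩
  have hle2 : ∀ ν : KoopIdx, Real.exp (lamIdx ν * t) * |aIdx ν x| * |phiIdx u₀ ν| ≤ 
      |aIdx ν x| * |phiIdx u₀ ν| := by
    intro ν
    have hlam : lamIdx ν ≤ 0 := by
      unfold lamIdx
      rw [kb_coe_map]
      have : 0 ≤ (ν.2.map (fun k : ℕ+ => (((k : ℕ) : ℝ)) ^ 2)).sum := by
        apply List.sum_nonneg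
        intro a ha
        obtain ⟨k, _, rfl⟩ := List.mem_map.1 ha
        positivity
      have h2 : 0 ≤ π ^ 2 * ((((ν.1 : ℕ) : ℝ)) ^ 2 + 
        (ν.2.map (fun k : ℕ+ => (((k : ℕ) : ℝ)) ^ 2)).sum) := by positivity
      linarith
    have h1 : Real.exp (lamIdx ν * t) ≤ 1 :=
      Real.exp_le_one_iff.2 (mul_nonpos_of_nonpos_of_nonneg hlam ht)
    rw [mul_assoc]
    exact mul_le_of_le_one_left (by positivity) h1
  have hS2 := Summable.of_nonneg_of_le (fun ν => by positivity) hle2 hS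
  exact (hS2.tsum_le_tsum hle2 hS).trans hB
end
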